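/- Every generalized weight 𝕀_n-module is a unique sum of absolutely prime (generalized weight) 𝕀_n-submodules; more precisely, every generalized weight 𝕀_n-module M with Supp(M) ⊆ Ω for an orbit Ω ∈ K^n/ℤ^n decomposes uniquely as a direct sum M = ⊕_{𝒟_Ω ⊆ 𝔻_Ω} M_{𝒟_Ω} where each M_{𝒟_Ω} ∈ GW(𝕀_n, 𝒟_Ω), and every nonzero M_{𝒟_Ω} is an absolutely prime 𝕀_n-module. -/

import Mathlib

set_option maxHeartbeats 1000000
set_option synthInstance.maxHeartbeats 400000
set_option linter.unusedSectionVars false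

namespace IDO

open scoped TensorProduct

noncomputable section

variable (K : Type*) [Field K] [CharZero K] (n : ℕ)

/-- The polynomial algebra `P_n = K[x_1, …, x_n]`. -/
abbrev P := MvPolynomial (Fin n) K

/-- The multiplication operator `x_i`. -/
def xOp (i : Fin n) : Module.End K (P K n) := LinearMap.mulLeft K (MvPolynomial.X i)

/-- The partial derivative `∂_i`. -/
def dOp (i : Fin n) : Module.End K (P K n) := (MvPolynomial.pderiv i).toLinearMap

/-- The integration operator `∫_i`, sending `x^α ↦ x^{α+e_i}/(α_i+1)`. -/
def intOp (i : Fin n) : Module.End K (P K n) :=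
  ((MvPolynomial.basisMonomials (Fin n) K).constr K)
    (fun α => (((α i : ℕ) : K) + 1)⁻¹ •
      (MvPolynomial.monomial (α + Finsupp.single i 1) (1 : K)))

/-- The algebra of polynomial integro-differential operators `𝕀_n`, as a subalgebra of
`End_K(P_n)` generated by the `x_i`, `∂_i` and `∫_i`. -/
def InSub : Subalgebra K (Module.End K (P K n)) :=
  Algebra.adjoin K (Set.range (xOp K n) ∪ Set.range (dOp K n) ∪ Set.range (intOp K n))

/-- The algebra `𝕀_n` (as a type, with its canonical ring structure). -/
def In : Type _ := InSub K n

instance : Ring (In K n) := inferInstanceAs (Ring (InSub K n))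
instance : Algebra K (In K n) := inferInstanceAs (Algebra K (InSub K n))
instance : Module (In K n) (P K n) := inferInstanceAs (Module (InSub K n) (P K n))
instance : IsScalarTower K (In K n) (P K n) :=
  inferInstanceAs (IsScalarTower K (InSub K n) (P K n))

/-- `x_i` as an element of `𝕀_n`. -/
def xEl (i : Fin n) : In K n :=
  show InSub K n from
    ⟨xOp K n i, Algebra.subset_adjoin (Set.mem_union_left _ (Set.mem_union_left _ ⟨i, rfl⟩))⟩

/-- `∂_i` as an element of `𝕀_n`. -/
def dEl (i : Fin n) : In K n :=
  show InSub K n from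
    ⟨dOp K n i, Algebra.subset_adjoin (Set.mem_union_left _ (Set.mem_union_right _ ⟨i, rfl⟩))⟩

/-- `∫_i` as an element of `𝕀_n`. -/
def intEl (i : Fin n) : In K n :=
  show InSub K n from
    ⟨intOp K n i, Algebra.subset_adjoin (Set.mem_union_right _ ⟨i, rfl⟩)⟩

/-- `H_i = ∂_i x_i` as an element of `𝕀_n`. -/
def HEl (i : Fin n) : In K n := dEl K n i * xEl K n i

section Modules

variable (M : Type*) [AddCommGroup M] [Module K M] [Module (In K n) M]
  [IsScalarTower K (In K n) M]

/-- The weight space `M_λ = {m | H_i m = λ_i m for all i}`. -/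
def weightSpace (lam : Fin n → K) : Submodule K M where
  carrier := {m | ∀ i, HEl K n i • m = lam i • m}
  add_mem' := by
    intro a b ha hb i
    rw [smul_add, ha i, hb i, smul_add]
  zero_mem' := by intro i; simp
  smul_mem' := by
    intro c m hm i
    rw [← smul_comm c (HEl K n i) m, hm i, smul_smul, mul_comm, ← smul_smul]

private lemma pow_smul_zero_mono {a : In K n} {m : M} {s s' : ℕ}
    (h : (a ^ s) • m = 0) (hle : s ≤ s') : (a ^ s') • m = 0 := by
  obtain ⟨k, rfl⟩ := Nat.exists_eq_add_of_le hle
  rw [add_comm s k, pow_add, mul_smul, h, smul_zero]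

/-- The generalized weight space `M^λ = {m | (H_i − λ_i)^N m = 0 for some N and all i}`. -/
def genWeightSpace (lam : Fin n → K) : Submodule K M where
  carrier := {m | ∃ N : ℕ, ∀ i,
    ((HEl K n i - algebraMap K (In K n) (lam i)) ^ N) • m = 0}
  add_mem' := by
    rintro a b ⟨Na, ha⟩ ⟨Nb, hb⟩
    refine ⟨Na ⊔ Nb, fun i => ?_⟩
    rw [smul_add, pow_smul_zero_mono K n M (ha i) le_sup_left,
      pow_smul_zero_mono K n M (hb i) le_sup_right, add_zero]
  zero_mem' := ⟨0, fun i => smul_zero _⟩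
  smul_mem' := by
    rintro c m ⟨N, hN⟩
    exact ⟨N, fun i => by rw [← smul_comm c _ m, hN i, smul_zero]⟩

/-- `M` is a weight module: `M = ⊕_λ M_λ`. -/
def IsWeightModule : Prop :=
  letI := Classical.decEq (Fin n → K)
  DirectSum.IsInternal (fun lam : Fin n → K => weightSpace K n M lam)

/-- `M` is a generalized weight module: `M = ⊕_λ M^λ`. -/
def IsGenWeightModule : Prop :=
  letI := Classical.decEq (Fin n → K)
  DirectSum.IsInternal (fun lam : Fin n → K => genWeightSpace K n M lam)

/-- The support `Supp(M) = {λ | M^λ ≠ 0}`. -/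
def supp : Set (Fin n → K) := {lam | genWeightSpace K n M lam ≠ ⊥}

/-- `M` is an indecomposable `𝕀_n`-module. -/
def IsIndecomposableMod : Prop :=
  Nontrivial M ∧ ∀ p q : Submodule (In K n) M, IsCompl p q → p = ⊥ ∨ q = ⊥

/-- The annihilator of an `𝕀_n`-module, as a set. -/
def annSet : Set (In K n) := {a | ∀ m : M, a • m = 0}

end Modules

/-- A prime (two-sided) ideal of the noncommutative ring `𝕀_n`, given as a set:
`S ≠ 𝕀_n` and `a 𝕀_n b ⊆ S → a ∈ S ∨ b ∈ S`. -/
def IsPrimeSet (S : Set (In K n)) : Prop :=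
  S ≠ Set.univ ∧ ∀ a b : In K n, (∀ r : In K n, a * r * b ∈ S) → a ∈ S ∨ b ∈ S

-- orbits
/-- The `ℤ^n`-orbit of `λ ∈ K^n`. -/
def orbitOf (lam : Fin n → K) : Set (Fin n → K) :=
  {mu | ∀ i, ∃ z : ℤ, mu i - lam i = (z : K)}

/-- The setoid on `K^n` whose classes are the `ℤ^n`-orbits. -/
def orbitSetoid : Setoid (Fin n → K) where
  r mu nu := ∀ i, ∃ z : ℤ, mu i - nu i = (z : K)
  iseqv := by
    constructor
    · intro x i; exact ⟨0, by simp⟩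
    · intro x y h i
      obtain ⟨z, hz⟩ := h i
      exact ⟨-z, by push_cast; linear_combination -hz⟩
    · intro x y z hxy hyz i
      obtain ⟨a, ha⟩ := hxy i
      obtain ⟨b, hb⟩ := hyz i
      exact ⟨a + b, by push_cast; linear_combination ha + hb⟩

/-- `𝔻_Ω = {i | Ω_i = ℤ}` for the orbit `Ω` of `λ`. -/
def DD (lam : Fin n → K) : Set (Fin n) := {i | ∃ z : ℤ, lam i = (z : K)}

/-- `λ` is the normalized representative of its orbit: integer coordinates are `0`. -/
def IsNormalized (lam : Fin n → K) : Prop := ∀ i, (∃ z : ℤ, lam i = (z : K)) → lam i = 0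


-- I_1 specifics
/-- The matrix units `e_{st} = ∫^s ∂^t − ∫^{s+1} ∂^{t+1}` of `𝕀_1`. -/
def eEl1 (s t : ℕ) : In K 1 :=
  intEl K 1 0 ^ s * dEl K 1 0 ^ t - intEl K 1 0 ^ (s + 1) * dEl K 1 0 ^ (t + 1)

/-- `F = ⊕ K e_{st}`, the unique proper two-sided ideal of `𝕀_1`, here as the left ideal
generated by the `e_{st}` (the two coincide). -/
def Fideal : Submodule (In K 1) (In K 1) :=
  Submodule.span (In K 1) {a | ∃ s t : ℕ, a = eEl1 K s t}

/-- The left ideal `F + 𝕀_1 (H − μ)^s`. -/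
def MslIdeal (s : ℕ) (mu : K) : Submodule (In K 1) (In K 1) :=
  Fideal K ⊔ Submodule.span (In K 1) {(HEl K 1 0 - algebraMap K (In K 1) mu) ^ s}

/-- The `𝕀_1`-module `M(s,μ) = 𝕀_1/(F + 𝕀_1 (H − μ)^s)`. -/
def Msl (s : ℕ) (mu : K) := (In K 1) ⧸ MslIdeal K s mu

instance (s : ℕ) (mu : K) : AddCommGroup (Msl K s mu) :=
  inferInstanceAs (AddCommGroup ((In K 1) ⧸ MslIdeal K s mu))
instance (s : ℕ) (mu : K) : Module (In K 1) (Msl K s mu) :=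
  inferInstanceAs (Module (In K 1) ((In K 1) ⧸ MslIdeal K s mu))
instance (s : ℕ) (mu : K) : Module K (Msl K s mu) :=
  inferInstanceAs (Module K ((In K 1) ⧸ MslIdeal K s mu))
instance (s : ℕ) (mu : K) : IsScalarTower K (In K 1) (Msl K s mu) :=
  inferInstanceAs (IsScalarTower K (In K 1) ((In K 1) ⧸ MslIdeal K s mu))

-- two-sided ideals of I_n
/-- The element `e_{st}(i) ∈ 𝕀_n` built from the `i`-th tensor factor. -/
def eElN (i : Fin n) (s t : ℕ) : In K n :=
  intEl K n i ^ s * dEl K n i ^ t - intEl K n i ^ (s + 1) * dEl K n i ^ (t + 1)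

/-- The height one prime `𝔭_i`, the two-sided ideal of `𝕀_n` generated by `F(i)`. -/
def pIdeal (i : Fin n) : TwoSidedIdeal (In K n) :=
  TwoSidedIdeal.span {a | ∃ s t : ℕ, a = eElN K n i s t}

/-- `𝔞_n(I) = Σ_{i ∈ I} 𝔭_i`. -/
def aIdeal (I : Set (Fin n)) : TwoSidedIdeal (In K n) := ⨆ i ∈ I, pIdeal K n i


-- bundled modules
universe u

/-- A bundled `𝕀_n`-module (with compatible `K`-structure). -/
structure ModN (K : Type u) [Field K] [CharZero K] (n : ℕ) : Type (u + 1) where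
  carrier : Type u
  [instAdd : AddCommGroup carrier]
  [instK : Module K carrier]
  [instIn : Module (In K n) carrier]
  [instTower : IsScalarTower K (In K n) carrier]

attribute [instance] ModN.instAdd ModN.instK ModN.instIn ModN.instTower

/-- The endomorphism of `M_1 ⊗ ⋯ ⊗ M_n` acting by `a ∈ 𝕀_1` on the `i`-th factor. -/
def tprodMap (Mi : Fin n → ModN K 1) (i : Fin n) (a : In K 1) :
    (⨂[K] j, (Mi j).carrier) →ₗ[K] ⨂[K] j, (Mi j).carrier :=
  PiTensorProduct.map (Function.update
    (fun j => (LinearMap.id : (Mi j).carrier →ₗ[K] (Mi j).carrier)) i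
    (DistribMulAction.toLinearMap K ((Mi i).carrier) a))

/-- The `𝕀_n`-module `M` "is" the tensor product `M_1 ⊗ ⋯ ⊗ M_n` of the `𝕀_1`-modules `M_i`:
there is a `K`-linear isomorphism under which the generators `x_i, ∂_i, ∫_i` of `𝕀_n` act on
the `i`-th tensor factor via the corresponding generators of `𝕀_1`. -/
def RealizesTensor (Mi : Fin n → ModN K 1) (M : Type*) [AddCommGroup M] [Module K M]
    [Module (In K n) M] [IsScalarTower K (In K n) M] : Prop :=
  ∃ φ : M ≃ₗ[K] ⨂[K] j, (Mi j).carrier,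
    ∀ (i : Fin n) (m : M),
      φ (xEl K n i • m) = tprodMap K n Mi i (xEl K 1 0) (φ m) ∧
      φ (dEl K n i • m) = tprodMap K n Mi i (dEl K 1 0) (φ m) ∧
      φ (intEl K n i • m) = tprodMap K n Mi i (intEl K 1 0) (φ m)

/-- `M` is (isomorphic to) the simple weight module `M(𝒟_Ω)` attached to the orbit of `λ`
and the subset `𝒟 ⊆ 𝔻_Ω`: the tensor product of copies of `K[x]` (for `i ∈ 𝒟`) and of
`M(1, λ_i)` (for `i ∉ 𝒟`). -/
def RealizesMD (lam : Fin n → K) (D : Set (Fin n)) (M : Type*) [AddCommGroup M] [Module K M]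
    [Module (In K n) M] [IsScalarTower K (In K n) M] : Prop :=
  ∃ Mi : Fin n → ModN K 1,
    (∀ i, i ∈ D → Nonempty ((Mi i).carrier ≃ₗ[In K 1] P K 1)) ∧
    (∀ i, i ∉ D → Nonempty ((Mi i).carrier ≃ₗ[In K 1] Msl K 1 (lam i))) ∧
    RealizesTensor K n Mi M

/-- `M` is (isomorphic to) the module `P_{n-1} ⊗ M(s, λ)` (with the copy of `M(s,λ)` placed
in position `j`). -/
def RealizesPMs (lam : Fin n → K) (j : Fin n) (s : ℕ) (M : Type*) [AddCommGroup M] [Module K M]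
    [Module (In K n) M] [IsScalarTower K (In K n) M] : Prop :=
  ∃ Mi : Fin n → ModN K 1,
    (∀ i, i ≠ j → Nonempty ((Mi i).carrier ≃ₗ[In K 1] P K 1)) ∧
    Nonempty ((Mi j).carrier ≃ₗ[In K 1] Msl K s (lam j)) ∧
    RealizesTensor K n Mi M

/-- Membership in the category `GW(𝕀_n, 𝒟_Ω)`: generalized weight modules with support in the
orbit of `λ` all of whose simple subquotients are isomorphic to `M(𝒟_Ω)`. -/
def InGWD (lam : Fin n → K) (D : Set (Fin n)) (M : Type*) [AddCommGroup M] [Module K M]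
    [Module (In K n) M] [IsScalarTower K (In K n) M] : Prop :=
  IsGenWeightModule K n M ∧ supp K n M ⊆ orbitOf K n lam ∧
  ∀ (p q : Submodule (In K n) M), p ≤ q →
    IsSimpleModule (In K n) (q ⧸ Submodule.comap q.subtype p) →
    RealizesMD K n lam D (q ⧸ Submodule.comap q.subtype p)

/-- The support `S(𝒟_Ω) = ℕ_+^{𝒟_Ω} × ∏_{i ∉ 𝒟_Ω} (λ_i + ℤ)` of the module `M(𝒟_Ω)`. -/
def SuppMD (lam : Fin n → K) (D : Set (Fin n)) : Set (Fin n → K) :=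
  {mu | (∀ i ∈ D, ∃ m : ℕ, 0 < m ∧ mu i = (m : K)) ∧
        (∀ i ∉ D, ∃ z : ℤ, mu i = lam i + (z : K))}

/-- `M` is an absolutely prime `𝕀_n`-module: its annihilator is a prime ideal and every
nonzero subfactor of `M` has the same annihilator. -/
def IsAbsolutelyPrime (M : Type*) [AddCommGroup M] [Module K M]
    [Module (In K n) M] [IsScalarTower K (In K n) M] : Prop :=
  IsPrimeSet K n (annSet K n M) ∧
  ∀ (p q : Submodule (In K n) M), p ≤ q →
    Nontrivial (q ⧸ Submodule.comap q.subtype p) →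
    annSet K n (q ⧸ Submodule.comap q.subtype p) = annSet K n M


-- the commutative subalgebra D_n = K[H_1, …, H_n]
lemma xEl_smul (i : Fin n) (p : P K n) : xEl K n i • p = MvPolynomial.X i * p := rfl

lemma dEl_smul (i : Fin n) (p : P K n) : dEl K n i • p = MvPolynomial.pderiv i p := rfl

lemma hEl_monomial (i : Fin n) (α : Fin n →₀ ℕ) (c : K) :
    HEl K n i • (MvPolynomial.monomial α c : P K n)
      = (((α i : ℕ) : K) + 1) • MvPolynomial.monomial α c := by
  have hx : xEl K n i • (MvPolynomial.monomial α c : P K n)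
      = MvPolynomial.monomial (α + Finsupp.single i 1) c := by
    rw [xEl_smul, MvPolynomial.X, MvPolynomial.monomial_mul, one_mul, add_comm]
  rw [HEl, mul_smul, hx, dEl_smul, MvPolynomial.pderiv_monomial,
    add_tsub_cancel_right, MvPolynomial.smul_monomial, Finsupp.add_apply,
    Finsupp.single_eq_same, smul_eq_mul]
  congr 1
  push_cast
  ring

private lemma In_ext {a b : In K n} (h : ∀ p : P K n, a • p = b • p) : a = b := by
  have : (show InSub K n from a) = (show InSub K n from b) :=
    Subtype.ext (LinearMap.ext fun p => h p)
  exact this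

lemma hEl_comm (i j : Fin n) : HEl K n i * HEl K n j = HEl K n j * HEl K n i := by
  apply In_ext
  intro p
  induction p using MvPolynomial.induction_on' with
  | monomial α c =>
      have key : ∀ a b : Fin n, (HEl K n a * HEl K n b) • (MvPolynomial.monomial α c : P K n)
          = ((((α b : ℕ) : K) + 1) * (((α a : ℕ) : K) + 1)) • MvPolynomial.monomial α c := by
        intro a b
        rw [mul_smul, hEl_monomial, ← smul_comm, hEl_monomial, smul_smul]
      rw [key, key, mul_comm]
  | add p q hp hq =>
      rw [smul_add, smul_add, hp, hq]

/-- `D_n = K[H_1, …, H_n]` as a subalgebra of `𝕀_n`. -/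
def DnSub : Subalgebra K (In K n) := Algebra.adjoin K (Set.range (HEl K n))

/-- The commutative algebra `D_n` (as a type). -/
def Dn : Type _ := DnSub K n

instance : CommRing (Dn K n) :=
  Algebra.adjoinCommRingOfComm K (by rintro a ⟨i, rfl⟩ b ⟨j, rfl⟩; exact hEl_comm K n i j)

instance : Algebra K (Dn K n) := inferInstanceAs (Algebra K (DnSub K n))

/-- The inclusion `D_n → 𝕀_n`. -/
def dnVal : Dn K n →+* In K n := ((DnSub K n).val : DnSub K n →ₐ[K] In K n).toRingHom

/-- `H_i` as an element of `D_n`. -/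
def HElD (i : Fin n) : Dn K n :=
  show DnSub K n from ⟨HEl K n i, Algebra.subset_adjoin ⟨i, rfl⟩⟩

lemma dn_comm (d : Dn K n) (i : Fin n) :
    dnVal K n d * HEl K n i = HEl K n i * dnVal K n d := by
  have h1 : DnSub K n ≤ Subalgebra.centralizer K (Set.range (HEl K n)) := by
    apply Algebra.adjoin_le
    rintro x ⟨j, rfl⟩
    rw [SetLike.mem_coe, Subalgebra.mem_centralizer_iff]
    rintro g ⟨i', rfl⟩
    exact hEl_comm K n i' j
  have h2 := (Subalgebra.mem_centralizer_iff K).mp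
    (h1 (show DnSub K n from d).2) (HEl K n i) ⟨i, rfl⟩
  exact h2.symm


section DnModules

variable (M : Type*) [AddCommGroup M] [Module K M] [Module (In K n) M]
  [IsScalarTower K (In K n) M]

lemma genWS_stable (lam : Fin n → K) {m : M} (hm : m ∈ genWeightSpace K n M lam)
    (d : Dn K n) : dnVal K n d • m ∈ genWeightSpace K n M lam := by
  obtain ⟨N, hN⟩ := hm
  refine ⟨N, fun i => ?_⟩
  have hc : Commute (dnVal K n d) ((HEl K n i - algebraMap K (In K n) (lam i)) ^ N) := by
    apply Commute.pow_right
    exact Commute.sub_right (dn_comm K n d i) ((Algebra.commutes (lam i) (dnVal K n d)).symm)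
  rw [← mul_smul, ← hc.eq, mul_smul, hN i, smul_zero]

instance genWS_smul (lam : Fin n → K) : SMul (Dn K n) (genWeightSpace K n M lam) :=
  ⟨fun d w => ⟨dnVal K n d • (w : M), genWS_stable K n M lam w.2 d⟩⟩

instance genWS_module (lam : Fin n → K) : Module (Dn K n) (genWeightSpace K n M lam) :=
  Module.ofMinimalAxioms
    (fun d x y => Subtype.ext (smul_add (dnVal K n d) (x : M) (y : M)))
    (fun d d' x => Subtype.ext (show dnVal K n (d + d') • (x : M)
      = dnVal K n d • (x : M) + dnVal K n d' • (x : M) by rw [map_add, add_smul]))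
    (fun d d' x => Subtype.ext (show dnVal K n (d * d') • (x : M)
      = dnVal K n d • (dnVal K n d' • (x : M)) by rw [map_mul, mul_smul]))
    (fun x => Subtype.ext (show dnVal K n 1 • (x : M) = (x : M) by rw [map_one, one_smul]))

instance genWS_tower (lam : Fin n → K) :
    IsScalarTower K (Dn K n) (genWeightSpace K n M lam) :=
  ⟨fun c d w => Subtype.ext (show dnVal K n (c • d) • (w : M) = c • (dnVal K n d • (w : M)) by
    rw [show dnVal K n (c • d) = c • dnVal K n d from map_smul (DnSub K n).val c d, smul_assoc])⟩

end DnModules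

/-- The maximal ideal `𝔪_λ = (H_1 − λ_1, …, H_n − λ_n)` of `D_n`. -/
def mIdeal (lam : Fin n → K) : Ideal (Dn K n) :=
  Ideal.span {d | ∃ i, d = HElD K n i - algebraMap K (Dn K n) (lam i)}

/-- The category `LF_𝔪(D_n)` of `𝔪_λ`-locally finite `D_n`-modules: every cyclic submodule is
finite dimensional over `K` and annihilated by a power of `𝔪_λ`. -/
def IsLF (lam : Fin n → K) (N : Type*) [AddCommGroup N] [Module K N] [Module (Dn K n) N]
    [IsScalarTower K (Dn K n) N] : Prop :=
  ∀ x : N, FiniteDimensional K ((Submodule.span (Dn K n) {x}).restrictScalars K) ∧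
    ∃ s : ℕ, ∀ i, ((HElD K n i - algebraMap K (Dn K n) (lam i)) ^ s) • x = 0

-- the algebra B_n = 𝕀_n/𝔞_n
/-- The maximal ideal `𝔞_n = 𝔭_1 + ⋯ + 𝔭_n` of `𝕀_n`. -/
def aFull : TwoSidedIdeal (In K n) := aIdeal K n Set.univ

/-- The skew Laurent polynomial algebra `B_n = 𝕀_n/𝔞_n`. -/
def Bn : Type _ := (aFull K n).ringCon.Quotient

instance : Ring (Bn K n) := inferInstanceAs (Ring (aFull K n).ringCon.Quotient)

/-- The quotient map `𝕀_n → B_n`. -/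
def toBn : In K n →+* Bn K n := RingCon.mk' _

lemma toBn_surjective : Function.Surjective (toBn K n) :=
  Quotient.mk''_surjective

/-- The composite `D_n → 𝕀_n → B_n`. -/
def bnD : Dn K n →+* Bn K n := (toBn K n).comp (dnVal K n)

/-- `B_n` as a right `D_n`-module (written as a left module structure, `d • b = b ⬝ d`). -/
instance : SMul (Dn K n) (Bn K n) := ⟨fun d b => b * bnD K n d⟩

instance : Module (Dn K n) (Bn K n) :=
  Module.ofMinimalAxioms
    (fun d x y => show (x + y) * bnD K n d = x * bnD K n d + y * bnD K n d from add_mul _ _ _)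
    (fun d d' x => show x * bnD K n (d + d') = x * bnD K n d + x * bnD K n d' by
      rw [map_add, mul_add])
    (fun d d' x => show x * bnD K n (d * d') = (x * bnD K n d') * bnD K n d by
      rw [mul_comm d d', map_mul, ← mul_assoc])
    (fun x => show x * bnD K n 1 = x by rw [map_one, mul_one])

instance : SMulCommClass (Dn K n) (Bn K n) (Bn K n) :=
  ⟨fun d b m => show (b * m) * bnD K n d = b * (m * bnD K n d) from mul_assoc b m (bnD K n d)⟩

/-- The induced module `B_n ⊗_{D_n} N` of a `D_n`-module `N`. -/
def Ind (N : Type*) [AddCommGroup N] [Module (Dn K n) N] : Type _ :=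
  (Bn K n) ⊗[Dn K n] N

section Ind

variable (N : Type*) [AddCommGroup N] [Module (Dn K n) N]

instance : AddCommGroup (Ind K n N) :=
  inferInstanceAs (AddCommGroup ((Bn K n) ⊗[Dn K n] N))

instance indModuleBn : Module (Bn K n) (Ind K n N) :=
  inferInstanceAs (Module (Bn K n) ((Bn K n) ⊗[Dn K n] N))

instance indModuleDn : Module (Dn K n) (Ind K n N) :=
  inferInstanceAs (Module (Dn K n) ((Bn K n) ⊗[Dn K n] N))

instance indModuleIn : Module (In K n) (Ind K n N) := Module.compHom _ (toBn K n)

instance indModuleK : Module K (Ind K n N) := Module.compHom _ (algebraMap K (Dn K n))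

lemma bn_algebraMap_comm (c : K) (u : Bn K n) :
    toBn K n (algebraMap K (In K n) c) * u = u * toBn K n (algebraMap K (In K n) c) := by
  obtain ⟨r, rfl⟩ := toBn_surjective K n u
  rw [← map_mul, ← map_mul, Algebra.commutes]

lemma dnVal_algebraMap (c : K) :
    dnVal K n (algebraMap K (Dn K n) c) = algebraMap K (In K n) c :=
  AlgHom.commutes (DnSub K n).val c

lemma ind_key (c : K) (w : (Bn K n) ⊗[Dn K n] N) :
    (toBn K n (algebraMap K (In K n) c)) • w = (algebraMap K (Dn K n) c) • w := by
  induction w using TensorProduct.induction_on with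
  | zero => rw [smul_zero, smul_zero]
  | tmul b x =>
      rw [TensorProduct.smul_tmul', TensorProduct.smul_tmul']
      congr 1
      show toBn K n (algebraMap K (In K n) c) * b = b * bnD K n (algebraMap K (Dn K n) c)
      have h1 : bnD K n (algebraMap K (Dn K n) c) = toBn K n (algebraMap K (In K n) c) := by
        show toBn K n (dnVal K n (algebraMap K (Dn K n) c)) = _
        rw [dnVal_algebraMap]
      rw [h1, bn_algebraMap_comm]
  | add x y hx hy => rw [smul_add, smul_add, hx, hy]

instance indTower : IsScalarTower K (In K n) (Ind K n N) := by
  constructor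
  intro c a v
  show toBn K n (c • a) • v = algebraMap K (Dn K n) c • ((toBn K n a : Bn K n) • v)
  rw [Algebra.smul_def, map_mul, mul_smul]
  exact ind_key K n N c _

end Ind


section BnQuot

variable (J : Submodule (Bn K n) (Bn K n))

instance : Module (In K n) (Bn K n ⧸ J) := Module.compHom _ (toBn K n)

instance : Module K (Bn K n ⧸ J) :=
  Module.compHom _ ((toBn K n).comp (algebraMap K (In K n)))

instance : IsScalarTower K (In K n) (Bn K n ⧸ J) := by
  constructor
  intro c a v
  show toBn K n (c • a) • v = (toBn K n (algebraMap K (In K n) c)) • (toBn K n a • v)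
  rw [Algebra.smul_def, map_mul, mul_smul]

end BnQuot

/-- The `𝕀_n`-module `M` "is" the tensor product `A ⊗ B` of an `𝕀_m`-module `A` and an
`𝕀_{n-m}`-module `B`: there is a `K`-linear isomorphism under which the generators of `𝕀_n`
with index `< m` act on the first factor (via the corresponding generators of `𝕀_m`) and the
remaining generators act on the second factor (via the generators of `𝕀_{n-m}`). -/
def RealizesSplit (m : ℕ) (A : Type*) [AddCommGroup A] [Module K A] [Module (In K m) A]
    [IsScalarTower K (In K m) A]
    (B : Type*) [AddCommGroup B] [Module K B] [Module (In K (n - m)) B]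
    [IsScalarTower K (In K (n - m)) B]
    (M : Type*) [AddCommGroup M] [Module K M] [Module (In K n) M]
    [IsScalarTower K (In K n) M] : Prop :=
  ∃ φ : M ≃ₗ[K] A ⊗[K] B,
    (∀ (i : Fin n) (hi : (i : ℕ) < m) (v : M),
      φ (xEl K n i • v) = LinearMap.rTensor B
        (DistribMulAction.toLinearMap K A (xEl K m ⟨i, hi⟩)) (φ v) ∧
      φ (dEl K n i • v) = LinearMap.rTensor B
        (DistribMulAction.toLinearMap K A (dEl K m ⟨i, hi⟩)) (φ v) ∧
      φ (intEl K n i • v) = LinearMap.rTensor B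
        (DistribMulAction.toLinearMap K A (intEl K m ⟨i, hi⟩)) (φ v)) ∧
    (∀ (i : Fin n) (hi : m ≤ (i : ℕ)) (v : M),
      φ (xEl K n i • v) = LinearMap.lTensor A
        (DistribMulAction.toLinearMap K B (xEl K (n - m) ⟨(i : ℕ) - m, by omega⟩)) (φ v) ∧
      φ (dEl K n i • v) = LinearMap.lTensor A
        (DistribMulAction.toLinearMap K B (dEl K (n - m) ⟨(i : ℕ) - m, by omega⟩)) (φ v) ∧
      φ (intEl K n i • v) = LinearMap.lTensor A
        (DistribMulAction.toLinearMap K B (intEl K (n - m) ⟨(i : ℕ) - m, by omega⟩)) (φ v))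

end


section Rel
variable {K : Type*} [Field K] [CharZero K] {n : ℕ}

lemma aux_ext {a b : In K n}
    (h : ∀ (α : Fin n →₀ ℕ), a • (MvPolynomial.monomial α 1 : P K n) = b • MvPolynomial.monomial α 1) :
    a = b := by
  have : (show InSub K n from a) = (show InSub K n from b) := by
    apply Subtype.ext
    apply (MvPolynomial.basisMonomials (Fin n) K).ext
    intro α
    rw [MvPolynomial.coe_basisMonomials]
    exact h α
  exact this

lemma int_mon (i : Fin n) (α : Fin n →₀ ℕ) (c : K) :
    intEl K n i • (MvPolynomial.monomial α c : P K n)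
      = MvPolynomial.monomial (α + Finsupp.single i 1) ((((α i : ℕ) : K) + 1)⁻¹ * c) := by
  have h1 : (MvPolynomial.monomial α c : P K n) = c • MvPolynomial.monomial α 1 := by
    rw [MvPolynomial.smul_monomial, smul_eq_mul, mul_one]
  have h2 : intEl K n i • (MvPolynomial.monomial α 1 : P K n) = (((α i : ℕ) : K) + 1)⁻¹ •
      (MvPolynomial.monomial (α + Finsupp.single i 1) (1 : K)) := by
    show intOp K n i (MvPolynomial.monomial α 1) = _
    rw [intOp]
    have := (MvPolynomial.basisMonomials (Fin n) K).constr_basis K (fun α => (((α i : ℕ) : K) + 1)⁻¹ •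
      (MvPolynomial.monomial (α + Finsupp.single i 1) (1 : K))) α
    rwa [MvPolynomial.coe_basisMonomials] at this
  rw [h1, ← smul_comm c (intEl K n i), h2, smul_smul, MvPolynomial.smul_monomial, smul_eq_mul, mul_one,
    mul_comm]

lemma d_mon (i : Fin n) (α : Fin n →₀ ℕ) (c : K) :
    dEl K n i • (MvPolynomial.monomial α c : P K n)
      = MvPolynomial.monomial (α - Finsupp.single i 1) (c * (α i : ℕ)) := by
  rw [dEl_smul, MvPolynomial.pderiv_monomial]

lemma x_mon (i : Fin n) (α : Fin n →₀ ℕ) (c : K) :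
    xEl K n i • (MvPolynomial.monomial α c : P K n)
      = MvPolynomial.monomial (α + Finsupp.single i 1) c := by
  rw [xEl_smul, MvPolynomial.X, MvPolynomial.monomial_mul, one_mul, add_comm]

lemma H_mon (i : Fin n) (α : Fin n →₀ ℕ) (c : K) :
    HEl K n i • (MvPolynomial.monomial α c : P K n)
      = MvPolynomial.monomial α ((((α i : ℕ) : K) + 1) * c) := by
  rw [hEl_monomial, MvPolynomial.smul_monomial, smul_eq_mul]

lemma np1 (k : ℕ) : (k : K) + 1 ≠ 0 := by exact_mod_cast Nat.succ_ne_zero k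

lemma d_int (i : Fin n) : dEl K n i * intEl K n i = 1 := by
  apply aux_ext; intro α
  rw [mul_smul, int_mon, d_mon, one_smul]
  simp [np1]

lemma x_eq (i : Fin n) : xEl K n i = intEl K n i * HEl K n i := by
  apply aux_ext; intro α
  rw [mul_smul, H_mon, int_mon, x_mon]
  simp [np1]

lemma H_int (i : Fin n) : HEl K n i * intEl K n i = intEl K n i * HEl K n i + intEl K n i := by
  apply aux_ext; intro α
  rw [add_smul, mul_smul, mul_smul, H_mon, int_mon, int_mon, H_mon, ← map_add]
  congr 1
  have := np1 (K := K) (α i)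
  simp
  field_simp

lemma H_d (i : Fin n) : HEl K n i * dEl K n i = dEl K n i * HEl K n i - dEl K n i := by
  apply aux_ext; intro α
  rw [sub_smul, mul_smul, mul_smul, d_mon, H_mon, H_mon, d_mon, ← map_sub]
  congr 1
  rcases Nat.eq_zero_or_pos (α i) with h | h
  · simp [h]
  · obtain ⟨k, hk⟩ := Nat.exists_eq_succ_of_ne_zero h.ne'
    simp [hk]; ring

lemma H_sub_one (i : Fin n) : HEl K n i = 1 + xEl K n i * dEl K n i := by
  apply aux_ext; intro α
  rw [add_smul, mul_smul, one_smul, d_mon, x_mon, H_mon]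
  rcases Nat.eq_zero_or_pos (α i) with h | h
  · simp [h]
  · rw [tsub_add_cancel_of_le, ← map_add]
    · congr 1; ring
    · simp; omega

/-- idempotent -/
noncomputable def eE (K : Type*) [Field K] [CharZero K] (n : ℕ) (i : Fin n) : In K n := 1 - intEl K n i * dEl K n i

lemma int_d (i : Fin n) : intEl K n i * dEl K n i = 1 - eE K n i := by simp [eE]
lemma d_e (i : Fin n) : dEl K n i * eE K n i = 0 := by
  rw [eE, mul_sub, ← mul_assoc, d_int]; simp
lemma e_int (i : Fin n) : eE K n i * intEl K n i = 0 := by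
  rw [eE, sub_mul, mul_assoc, d_int]; simp
lemma H_e (i : Fin n) : HEl K n i * eE K n i = eE K n i := by
  rw [H_sub_one, add_mul, mul_assoc, d_e]; simp
lemma e_H (i : Fin n) : eE K n i * HEl K n i = eE K n i := by
  rw [H_sub_one, mul_add, x_eq, ← mul_assoc, ← mul_assoc, e_int]; simp

lemma comm_Hd {i j : Fin n} (h : i ≠ j) : Commute (HEl K n i) (dEl K n j) := by
  apply aux_ext; intro α
  rw [mul_smul, mul_smul, d_mon, H_mon, H_mon, d_mon]
  congr 1
  simp [Finsupp.single_eq_of_ne h]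

lemma comm_Hint {i j : Fin n} (h : i ≠ j) : Commute (HEl K n i) (intEl K n j) := by
  apply aux_ext; intro α
  rw [mul_smul, mul_smul, int_mon, H_mon, H_mon, int_mon]
  congr 1
  simp [Finsupp.single_eq_of_ne h, mul_comm]

lemma comm_dd {i j : Fin n} (h : i ≠ j) : Commute (dEl K n i) (dEl K n j) := by
  apply aux_ext; intro α
  rw [mul_smul, mul_smul, d_mon, d_mon, d_mon, d_mon, tsub_right_comm]
  congr 1
  simp [Finsupp.single_eq_of_ne h, Finsupp.single_eq_of_ne h.symm, mul_comm]

lemma comm_dint {i j : Fin n} (h : i ≠ j) : Commute (dEl K n i) (intEl K n j) := by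
  apply aux_ext; intro α
  rw [mul_smul, mul_smul, d_mon, int_mon, int_mon, d_mon]
  have : α - Finsupp.single i 1 + Finsupp.single j 1 = α + Finsupp.single j 1 - Finsupp.single i 1 := by
    ext k
    by_cases hk : k = i
    · subst hk; simp [Finsupp.single_eq_of_ne h]
    · simp [Finsupp.single_eq_of_ne hk]
  rw [this]
  congr 1
  simp [Finsupp.single_eq_of_ne h, Finsupp.single_eq_of_ne h.symm]

lemma comm_intint {i j : Fin n} (h : i ≠ j) : Commute (intEl K n i) (intEl K n j) := by
  apply aux_ext; intro α
  rw [mul_smul, mul_smul, int_mon, int_mon, int_mon, int_mon, add_right_comm]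
  congr 1
  simp [Finsupp.single_eq_of_ne h, Finsupp.single_eq_of_ne h.symm, mul_comm]

lemma comm_HH (i j : Fin n) : Commute (HEl K n i) (HEl K n j) := hEl_comm K n i j

/-- induction principle -/
lemma In_ind (S : Subalgebra K (In K n)) (hd : ∀ i, dEl K n i ∈ S) (hi : ∀ i, intEl K n i ∈ S)
    (hH : ∀ i, HEl K n i ∈ S) (a : In K n) : a ∈ S := by
  have key : ∀ (x : Module.End K (P K n)) (hx : x ∈ InSub K n), (show In K n from (⟨x, hx⟩ : InSub K n)) ∈ S := by
    intro x hx
    refine Algebra.adjoin_induction (p := fun x hx => (show In K n from (⟨x, hx⟩ : InSub K n)) ∈ S) ?_ ?_ ?_ ?_ hx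
    · rintro x ((⟨i, rfl⟩ | ⟨i, rfl⟩) | ⟨i, rfl⟩)
      · have : xEl K n i ∈ S := by rw [x_eq]; exact S.mul_mem (hi i) (hH i)
        exact this
      · exact hd i
      · exact hi i
    · intro r; exact S.algebraMap_mem r
    · intro x y hx hy h1 h2; exact S.add_mem h1 h2
    · intro x y hx hy h1 h2; exact S.mul_mem h1 h2
  exact key a.1 a.2

end Rel

section Mod
variable {K : Type*} [Field K] [CharZero K] {n : ℕ}
variable {M : Type*} [AddCommGroup M] [Module K M] [Module (In K n) M] [IsScalarTower K (In K n) M]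

/-- a K-subspace stable under the generators -/
def toSub (W : Submodule K M) (hd : ∀ i, ∀ m ∈ W, dEl K n i • m ∈ W)
    (hi : ∀ i, ∀ m ∈ W, intEl K n i • m ∈ W) (hH : ∀ i, ∀ m ∈ W, HEl K n i • m ∈ W) :
    Submodule (In K n) M where
  carrier := W
  add_mem' := W.add_mem
  zero_mem' := W.zero_mem
  smul_mem' := by
    intro a m hm
    let S : Subalgebra K (In K n) :=
      { carrier := {a | ∀ m ∈ W, a • m ∈ W}
        mul_mem' := fun {a b} ha hb m hm => by rw [mul_smul]; exact ha _ (hb _ hm)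
        add_mem' := fun {a b} ha hb m hm => by rw [add_smul]; exact W.add_mem (ha _ hm) (hb _ hm)
        algebraMap_mem' := fun r m hm => by rw [algebraMap_smul]; exact W.smul_mem r hm }
    exact In_ind S hd hi hH a m hm

lemma mem_toSub {W : Submodule K M} {hd hi hH} {m : M} :
    m ∈ toSub (n := n) W hd hi hH ↔ m ∈ W := Iff.rfl

end Mod

section Shift
variable {K : Type*} [Field K] [CharZero K] {n : ℕ}

/-- one-variable shift -/
noncomputable def sE (K : Type*) [Field K] [CharZero K] (n : ℕ) (i : Fin n) : ℤ → In K n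
  | Int.ofNat k => intEl K n i ^ k
  | Int.negSucc k => dEl K n i ^ (k + 1)

lemma sE_nat (i : Fin n) (k : ℕ) : sE K n i (k : ℤ) = intEl K n i ^ k := rfl
lemma sE_zero (i : Fin n) : sE K n i 0 = 1 := by
  have := sE_nat (K := K) i 0
  simpa using this
lemma sE_neg (i : Fin n) (k : ℕ) : sE K n i (-(k : ℤ)) = dEl K n i ^ k := by
  cases k with
  | zero => simpa using sE_zero (K := K) i
  | succ k => rw [show (-((k+1 : ℕ) : ℤ)) = Int.negSucc k by rw [Int.negSucc_eq]; push_cast; rfl]; rfl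

lemma d_sE (i : Fin n) (k : ℤ) : dEl K n i * sE K n i k = sE K n i (k - 1) := by
  rcases le_or_gt k 0 with h | h
  · obtain ⟨m, rfl⟩ := Int.exists_eq_neg_ofNat h
    rw [sE_neg, show (-(m:ℤ) - 1) = -((m+1 : ℕ) : ℤ) by push_cast; ring, sE_neg, pow_succ']
  · obtain ⟨m, rfl⟩ := Int.eq_succ_of_zero_lt h
    rw [show ((m : ℤ) + 1 - 1) = (m : ℤ) by ring, show ((m : ℤ) + 1) = ((m + 1 : ℕ) : ℤ) by push_cast; ring,
      sE_nat, sE_nat, pow_succ', ← mul_assoc, d_int, one_mul]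

lemma int_sE (i : Fin n) {k : ℤ} (h : 0 ≤ k) : intEl K n i * sE K n i k = sE K n i (k + 1) := by
  obtain ⟨m, rfl⟩ := Int.eq_ofNat_of_zero_le h
  rw [show ((m : ℤ) + 1) = ((m + 1 : ℕ) : ℤ) by push_cast; ring, sE_nat, sE_nat, pow_succ']

lemma int_sE_neg (i : Fin n) (k : ℤ) :
    intEl K n i * sE K n i k = sE K n i (k + 1) - eE K n i * sE K n i (k + 1) := by
  have : sE K n i k = dEl K n i * sE K n i (k + 1) := by rw [d_sE]; simp
  rw [this, ← mul_assoc, int_d, sub_mul, one_mul]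

lemma sE_d (i : Fin n) {k : ℤ} (h : k < 0) : sE K n i k = sE K n i (k + 1) * dEl K n i := by
  obtain ⟨m, hm⟩ := Int.exists_eq_neg_ofNat (show k + 1 ≤ 0 by omega)
  rw [show k = -((m+1 : ℕ) : ℤ) by push_cast; omega, sE_neg,
    show (-((m+1 : ℕ) : ℤ) + 1) = -(m : ℤ) by push_cast; ring, sE_neg, pow_succ]

lemma H_int_pow (i : Fin n) (k : ℕ) :
    HEl K n i * intEl K n i ^ k = intEl K n i ^ k * (HEl K n i + (k : In K n)) := by
  induction k with
  | zero => simp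
  | succ k ih =>
    rw [pow_succ, ← mul_assoc, ih, mul_assoc, add_mul, H_int, mul_assoc, mul_add,
      (Nat.cast_commute k (intEl K n i)).eq]
    push_cast
    noncomm_ring

lemma H_d_pow (i : Fin n) (k : ℕ) :
    HEl K n i * dEl K n i ^ k = dEl K n i ^ k * (HEl K n i - (k : In K n)) := by
  induction k with
  | zero => simp
  | succ k ih =>
    rw [pow_succ, ← mul_assoc, ih, mul_assoc, sub_mul, H_d, mul_assoc, mul_sub,
      (Nat.cast_commute k (dEl K n i)).eq]
    push_cast
    noncomm_ring

lemma H_sE (i : Fin n) (k : ℤ) :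
    HEl K n i * sE K n i k = sE K n i k * (HEl K n i + (k : In K n)) := by
  rcases le_or_gt k 0 with h | h
  · obtain ⟨m, rfl⟩ := Int.exists_eq_neg_ofNat h
    rw [sE_neg, H_d_pow]; push_cast; rw [sub_eq_add_neg]
  · obtain ⟨m, rfl⟩ := Int.eq_ofNat_of_zero_le h.le
    rw [sE_nat, H_int_pow]; push_cast; rfl

lemma comm_sE_of {i : Fin n} {a : In K n} (hd : Commute a (dEl K n i)) (hi : Commute a (intEl K n i))
    (k : ℤ) : Commute a (sE K n i k) := by
  rcases le_or_gt k 0 with h | h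
  · obtain ⟨m, rfl⟩ := Int.exists_eq_neg_ofNat h
    rw [sE_neg]; exact hd.pow_right m
  · obtain ⟨m, rfl⟩ := Int.eq_ofNat_of_zero_le h.le
    rw [sE_nat]; exact hi.pow_right m

lemma comm_d_sE {i j : Fin n} (h : i ≠ j) (k : ℤ) : Commute (dEl K n i) (sE K n j k) :=
  comm_sE_of (comm_dd h) (comm_dint h) k
lemma comm_int_sE {i j : Fin n} (h : i ≠ j) (k : ℤ) : Commute (intEl K n i) (sE K n j k) :=
  comm_sE_of (comm_dint h.symm).symm (comm_intint h) k
lemma comm_H_sE {i j : Fin n} (h : i ≠ j) (k : ℤ) : Commute (HEl K n i) (sE K n j k) :=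
  comm_sE_of (comm_Hd h) (comm_Hint h) k
lemma comm_sE_sE {i j : Fin n} (h : i ≠ j) (k l : ℤ) : Commute (sE K n i k) (sE K n j l) :=
  comm_sE_of (comm_d_sE h.symm k).symm (comm_int_sE h.symm k).symm l

lemma comm_e_of {i : Fin n} {a : In K n} (hd : Commute a (dEl K n i)) (hi : Commute a (intEl K n i)) :
    Commute a (eE K n i) :=
  (Commute.one_right a).sub_right (hi.mul_right hd)

/-- multi-shift -/
noncomputable def sh (K : Type*) [Field K] [CharZero K] (n : ℕ) (z : Fin n → ℤ) : In K n :=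
  Finset.univ.noncommProd (fun i => sE K n i (z i)) (fun _ _ _ _ h => comm_sE_sE h _ _)

/-- the rest of the shift -/
noncomputable def shr (K : Type*) [Field K] [CharZero K] (n : ℕ) (i : Fin n) (z : Fin n → ℤ) : In K n :=
  (Finset.univ.erase i).noncommProd (fun i => sE K n i (z i)) (fun _ _ _ _ h => comm_sE_sE h _ _)

lemma sh_eq (i : Fin n) (z : Fin n → ℤ) : sh K n z = sE K n i (z i) * shr K n i z :=
  (Finset.mul_noncommProd_erase _ (Finset.mem_univ i) (fun i => sE K n i (z i)) _).symm
lemma sh_eq' (i : Fin n) (z : Fin n → ℤ) : sh K n z = shr K n i z * sE K n i (z i) :=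
  (Finset.noncommProd_erase_mul _ (Finset.mem_univ i) (fun i => sE K n i (z i)) _).symm

lemma comm_shr_of {i : Fin n} {a : In K n} (z : Fin n → ℤ)
    (h : ∀ j, j ≠ i → Commute a (sE K n j (z j))) : Commute a (shr K n i z) := by
  apply Finset.noncommProd_commute
  intro j hj
  exact h j (Finset.ne_of_mem_erase hj)

lemma shr_update (i : Fin n) (z : Fin n → ℤ) (k : ℤ) : shr K n i (Function.update z i k) = shr K n i z := by
  apply Finset.noncommProd_congr rfl
  intro j hj
  rw [Function.update_of_ne (Finset.ne_of_mem_erase hj)]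

lemma sh_update (i : Fin n) (z : Fin n → ℤ) (k : ℤ) :
    sh K n (Function.update z i k) = sE K n i k * shr K n i z := by
  rw [sh_eq i, shr_update, Function.update_self]
lemma sh_update' (i : Fin n) (z : Fin n → ℤ) (k : ℤ) :
    sh K n (Function.update z i k) = shr K n i z * sE K n i k := by
  rw [sh_eq' i, shr_update, Function.update_self]

lemma d_sh (i : Fin n) (z : Fin n → ℤ) :
    dEl K n i * sh K n z = sh K n (Function.update z i (z i - 1)) := by
  rw [sh_update, sh_eq i, ← mul_assoc, d_sE]

lemma int_sh (i : Fin n) (z : Fin n → ℤ) (h : 0 ≤ z i) :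
    intEl K n i * sh K n z = sh K n (Function.update z i (z i + 1)) := by
  rw [sh_update, sh_eq i, ← mul_assoc, int_sE i h]

lemma int_sh_neg (i : Fin n) (z : Fin n → ℤ) :
    intEl K n i * sh K n z = sh K n (Function.update z i (z i + 1)) -
      eE K n i * sh K n (Function.update z i (z i + 1)) := by
  rw [sh_update, sh_eq i, ← mul_assoc, int_sE_neg i, sub_mul, mul_assoc]

lemma sh_d (i : Fin n) (z : Fin n → ℤ) (h : z i < 0) :
    sh K n z = sh K n (Function.update z i (z i + 1)) * dEl K n i := by
  rw [sh_update', mul_assoc, sh_eq' i, ← sE_d i h]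

lemma H_sh (i : Fin n) (z : Fin n → ℤ) :
    HEl K n i * sh K n z = sh K n z * (HEl K n i + ((z i : ℤ) : In K n)) := by
  have hc : Commute (HEl K n i) (shr K n i z) := comm_shr_of z fun j hj => comm_H_sE hj.symm _
  rw [sh_eq' i, ← mul_assoc, hc.eq, mul_assoc, H_sE, mul_assoc]

lemma sh_zero : sh K n 0 = 1 := by
  refine (Finset.noncommProd_eq_pow_card _ _ _ 1 ?_).trans (one_pow _)
  intro i _; exact sE_zero i

end Shift

section LE
variable {K : Type*} [Field K] [CharZero K] {n : ℕ}
variable {M : Type*} [AddCommGroup M] [Module K M] [Module (In K n) M] [IsScalarTower K (In K n) M]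

lemma dk_int (i : Fin n) (k : ℕ) : dEl K n i ^ (k+1) * intEl K n i = dEl K n i ^ k := by
  rw [pow_succ, mul_assoc, d_int, mul_one]

lemma dk_intk (i : Fin n) (k : ℕ) : dEl K n i ^ k * intEl K n i ^ k = 1 := by
  induction k with
  | zero => simp
  | succ k ih => rw [pow_succ, pow_succ', mul_assoc, ← mul_assoc (dEl K n i), d_int, one_mul, ih]

lemma dk_H (i : Fin n) (k : ℕ) : dEl K n i ^ k * HEl K n i = (HEl K n i + (k : In K n)) * dEl K n i ^ k := by
  rw [add_mul, H_d_pow, mul_sub, (Nat.cast_commute k (dEl K n i ^ k)).eq]; abel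

lemma e_dk_H (i : Fin n) (k : ℕ) : eE K n i * dEl K n i ^ k * HEl K n i =
    ((k : K) + 1) • (eE K n i * dEl K n i ^ k) := by
  rw [mul_assoc, dk_H, add_mul, mul_add, ← mul_assoc, e_H, (Nat.cast_commute k _).eq, ← mul_assoc, add_smul,
    one_smul, add_comm]
  congr 1
  rw [Algebra.smul_def, map_natCast, (Nat.cast_commute k _).eq]

/-- locally nilpotent part -/
def LL (K : Type*) [Field K] [CharZero K] {n : ℕ} (M : Type*) [AddCommGroup M] [Module K M]
    [Module (In K n) M] [IsScalarTower K (In K n) M] (i : Fin n) : Submodule (In K n) M :=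
  toSub (K := K) (n := n)
    { carrier := {m : M | ∃ k : ℕ, dEl K n i ^ k • m = 0}
      add_mem' := by
        rintro a b ⟨k, hk⟩ ⟨l, hl⟩
        refine ⟨k + l, ?_⟩
        rw [smul_add, pow_add, mul_smul _ _ b, hl, smul_zero, add_zero, ← pow_add, add_comm, pow_add, mul_smul, hk,
          smul_zero]
      zero_mem' := ⟨0, smul_zero _⟩
      smul_mem' := by
        rintro c m ⟨k, hk⟩
        exact ⟨k, by rw [← smul_comm c _ m, hk, smul_zero]⟩ }
    (by
      rintro j m ⟨k, hk⟩
      refine ⟨k, ?_⟩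
      by_cases h : i = j
      · subst h; rw [← mul_smul, ← pow_succ, pow_succ', mul_smul, hk, smul_zero]
      · rw [← mul_smul, ((comm_dd h).pow_left k).eq, mul_smul, hk, smul_zero])
    (by
      rintro j m ⟨k, hk⟩
      by_cases h : i = j
      · subst h; exact ⟨k+1, by rw [← mul_smul, dk_int, hk]⟩
      · exact ⟨k, by rw [← mul_smul, ((comm_dint h).pow_left k).eq, mul_smul, hk, smul_zero]⟩)
    (by
      rintro j m ⟨k, hk⟩
      refine ⟨k, ?_⟩
      by_cases h : i = j
      · subst h; rw [← mul_smul, dk_H, mul_smul, hk, smul_zero]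
      · rw [← mul_smul, ((comm_Hd (Ne.symm h)).symm.pow_left k).eq, mul_smul, hk, smul_zero])

/-- part killed by the ideal F(i) -/
def EE (K : Type*) [Field K] [CharZero K] {n : ℕ} (M : Type*) [AddCommGroup M] [Module K M]
    [Module (In K n) M] [IsScalarTower K (In K n) M] (i : Fin n) : Submodule (In K n) M :=
  toSub (K := K) (n := n)
    { carrier := {m : M | ∀ k : ℕ, (eE K n i * dEl K n i ^ k) • m = 0}
      add_mem' := by
        intro a b ha hb k
        rw [smul_add, ha, hb, add_zero]
      zero_mem' := fun k => smul_zero _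
      smul_mem' := by
        intro c m h k
        rw [← smul_comm c _ m, h, smul_zero] }
    (by
      intro j m hm k
      by_cases h : i = j
      · subst h; rw [← mul_smul, mul_assoc, ← pow_succ]; exact hm (k+1)
      · have hc : Commute (eE K n i * dEl K n i ^ k) (dEl K n j) := 
          ((comm_e_of (comm_dd (Ne.symm h)) (comm_dint (Ne.symm h))).symm).mul_left ((comm_dd h).pow_left k)
        rw [← mul_smul, hc.eq, mul_smul, hm k, smul_zero])
    (by
      intro j m hm k
      by_cases h : i = j
      · subst h
        cases k with
        | zero => rw [pow_zero, mul_one, ← mul_smul, e_int, zero_smul]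
        | succ k => rw [← mul_smul, mul_assoc, dk_int]; exact hm k
      · have hc : Commute (eE K n i * dEl K n i ^ k) (intEl K n j) := 
          ((comm_e_of (comm_dint h).symm (comm_intint (Ne.symm h))).symm).mul_left ((comm_dint h).pow_left k)
        rw [← mul_smul, hc.eq, mul_smul, hm k, smul_zero])
    (by
      intro j m hm k
      by_cases h : i = j
      · subst h
        rw [← mul_smul, e_dk_H, smul_assoc, hm k, smul_zero]
      · have hc : Commute (eE K n i * dEl K n i ^ k) (HEl K n j) := 
          ((comm_e_of (comm_Hd (Ne.symm h)) (comm_Hint (Ne.symm h))).symm).mul_left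
            ((comm_Hd (Ne.symm h)).symm.pow_left k)
        rw [← mul_smul, hc.eq, mul_smul, hm k, smul_zero])

lemma mem_LL {i : Fin n} {m : M} : m ∈ LL K M i ↔ ∃ k : ℕ, dEl K n i ^ k • m = 0 := Iff.rfl
lemma mem_EE {i : Fin n} {m : M} : m ∈ EE K M i ↔ ∀ k : ℕ, (eE K n i * dEl K n i ^ k) • m = 0 := Iff.rfl

lemma LL_EE_disj (i : Fin n) : Disjoint (LL K M i) (EE K M i) := by
  rw [Submodule.disjoint_def]
  rintro m ⟨k, hk⟩ hE
  induction k with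
  | zero => simpa using hk
  | succ k ih =>
    apply ih
    have := hE k
    rwa [eE, sub_mul, one_mul, sub_smul, mul_assoc, ← pow_succ', mul_smul, hk, smul_zero, sub_zero] at this

lemma mul_aeval_eval {a h : In K n} {c : K} (H : a * h = c • a) (p : Polynomial K) :
    a * Polynomial.aeval h p = p.eval c • a := by
  induction p using Polynomial.induction_on' with
  | add p q hp hq => rw [map_add, mul_add, hp, hq, Polynomial.eval_add, add_smul]
  | monomial k r =>
    rw [Polynomial.aeval_monomial, Polynomial.eval_monomial]
    have : a * h ^ k = c ^ k • a := by
      induction k with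
      | zero => simp
      | succ k ih => rw [pow_succ, ← mul_assoc, ih, smul_mul_assoc, H, smul_smul, pow_succ]
    rw [← mul_assoc, ← Algebra.commutes, mul_assoc, this, ← Algebra.smul_def, smul_smul]

lemma aeval_smul_eval {h : In K n} {c : K} {v : M} (H : h • v = c • v) (p : Polynomial K) :
    Polynomial.aeval h p • v = p.eval c • v := by
  induction p using Polynomial.induction_on' with
  | add p q hp hq => rw [map_add, add_smul, hp, hq, Polynomial.eval_add, add_smul]
  | monomial k r =>
    rw [Polynomial.aeval_monomial, Polynomial.eval_monomial]
    have : h ^ k • v = c ^ k • v := by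
      induction k with
      | zero => simp
      | succ k ih => rw [pow_succ', mul_smul, ih, ← smul_comm, H, smul_smul, pow_succ]
    rw [mul_smul, this, algebraMap_smul, smul_smul]

/-- product of linear factors -/
noncomputable def lp {K : Type*} [Field K] (l : List K) : Polynomial K :=
  (l.map (fun c => Polynomial.X - Polynomial.C c)).prod

/-- the H_i act locally finitely with eigenvalues in the orbit -/
def FinC (lam : Fin n → K) (M : Type*) [AddCommGroup M] [Module K M] [Module (In K n) M] : Prop :=
  ∀ (i : Fin n) (q : M), ∃ l : List K, (∀ c ∈ l, ∃ z : ℤ, c = lam i + z) ∧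
    Polynomial.aeval (HEl K n i) (lp l) • q = 0

lemma lp_nil : lp ([] : List K) = 1 := rfl
lemma lp_cons (c : K) (l : List K) : lp (c :: l) = (Polynomial.X - Polynomial.C c) * lp l := by simp [lp]
lemma lp_append (l l' : List K) : lp (l ++ l') = lp l * lp l' := by simp [lp]
lemma lp_eval_ne {c : K} {l : List K} (h : c ∉ l) : (lp l).eval c ≠ 0 := by
  induction l with
  | nil => simp [lp_nil]
  | cons a l ih =>
    rw [lp_cons, Polynomial.eval_mul]
    simp only [List.mem_cons, not_or] at h
    exact mul_ne_zero (by simpa [sub_eq_zero] using h.1) (ih h.2)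

lemma FinC.sub {lam : Fin n → K} (h : FinC lam M) (p : Submodule (In K n) M) : FinC lam p := by
  intro i q
  obtain ⟨l, hl, hq⟩ := h i q
  exact ⟨l, hl, Subtype.ext hq⟩

lemma FinC.quot {lam : Fin n → K} (h : FinC lam M) (p : Submodule (In K n) M) : FinC lam (M ⧸ p) := by
  intro i q
  obtain ⟨q, rfl⟩ := Submodule.Quotient.mk_surjective p q
  obtain ⟨l, hl, hq⟩ := h i q
  exact ⟨l, hl, by rw [← Submodule.Quotient.mk_smul, hq, Submodule.Quotient.mk_zero]⟩

lemma LL_EE_sup {lam : Fin n → K} (h : FinC lam M) (i : Fin n) (m : M) :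
    ∃ a : In K n, a • m ∈ LL K M i ∧ (1 - a) • m ∈ EE K M i := by
  obtain ⟨l, -, hl⟩ := h i m
  have key : ∃ T : ℕ, ∀ k ≥ T, (eE K n i * dEl K n i ^ k) • m = 0 := by
    have hfin : ∃ T : ℕ, ∀ k ≥ T, ((k : K) + 1) ∉ l := by
      have hf : {k : ℕ | ((k : K) + 1) ∈ l}.Finite := by
        apply Set.Finite.preimage (f := fun k : ℕ => (k : K) + 1) (s := {x | x ∈ l})
        · intro a _ b _ hab; simpa using hab
        · exact List.finite_toSet l
      obtain ⟨T, hT⟩ := hf.bddAbove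
      refine ⟨T + 1, fun k hk hk' => ?_⟩
      have := hT hk'
      omega
    obtain ⟨T, hT⟩ := hfin
    refine ⟨T, fun k hk => ?_⟩
    have h1 := mul_aeval_eval (e_dk_H (K := K) i k) (lp l)
    have h2 : ((eE K n i * dEl K n i ^ k) * Polynomial.aeval (HEl K n i) (lp l)) • m = 0 := by
      rw [mul_smul, hl, smul_zero]
    rw [h1, smul_assoc] at h2
    exact (smul_eq_zero.mp h2).resolve_left (lp_eval_ne (hT k hk))
  obtain ⟨T, hT⟩ := key
  refine ⟨1 - intEl K n i ^ T * dEl K n i ^ T, ⟨T, ?_⟩, fun k => ?_⟩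
  · rw [← mul_smul, mul_sub, ← mul_assoc, dk_intk, mul_one, one_mul, sub_self, zero_smul]
  · rw [sub_sub_cancel, ← mul_smul]
    rcases le_or_gt T k with h | h
    · obtain ⟨s, rfl⟩ := Nat.exists_eq_add_of_le h
      rw [mul_assoc, ← mul_assoc (dEl K n i ^ _), add_comm, pow_add, mul_assoc _ _ (intEl K n i ^ T),
        dk_intk, mul_one, ← pow_add]
      exact hT _ (by omega)
    · obtain ⟨s, rfl⟩ := Nat.exists_eq_add_of_lt h
      rw [mul_assoc, ← mul_assoc (dEl K n i ^ _), add_assoc, pow_add (intEl K n i) k, ← mul_assoc (dEl K n i ^ _),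
        dk_intk, one_mul, pow_succ', ← mul_assoc, ← mul_assoc, e_int, zero_mul, zero_mul, zero_smul]

end LE

section GW1
lemma mem_iInf2 {R M ι : Type*} [Semiring R] [AddCommMonoid M] [Module R M] {s : Finset ι}
    (p : ι → Submodule R M) {x : M} : x ∈ ⨅ i ∈ s, p i ↔ ∀ i ∈ s, x ∈ p i := by
  simp only [Submodule.mem_iInf]

variable {K : Type*} [Field K] [CharZero K] {V : Type*} [AddCommGroup V] [Module K V]

lemma aeval_mem (f : Module.End K V) (W : Submodule K V) (hW : ∀ x ∈ W, f x ∈ W) (p : Polynomial K) {x : V}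
    (hx : x ∈ W) : Polynomial.aeval f p x ∈ W := by
  induction p using Polynomial.induction_on' with
  | add p q hp hq => rw [map_add]; exact W.add_mem hp hq
  | monomial k r =>
    rw [Polynomial.aeval_monomial]
    have : (f ^ k) x ∈ W := by
      induction k with
      | zero => simpa using hx
      | succ k ih => rw [pow_succ']; exact hW _ ih
    exact W.smul_mem r this

lemma single_dec (f : Module.End K V) (W : Submodule K V) (hW : ∀ x ∈ W, f x ∈ W) (O : Set K) (l : List K)
    (hl : ∀ c ∈ l, c ∈ O) (q : V) (hq : q ∈ W) (h : Polynomial.aeval f (lp l) q = 0) :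
    q ∈ ⨆ c ∈ O, W ⊓ f.maxGenEigenspace c := by
  induction l generalizing q with
  | nil => rw [lp_nil, map_one] at h; rw [show q = 0 from h]; exact Submodule.zero_mem _
  | cons c l ih =>
    set X := ⨆ c ∈ O, W ⊓ f.maxGenEigenspace c with hX
    have hc : c ∈ O := hl c (by simp)
    have hXW : X ≤ W := iSup₂_le fun c _ => inf_le_left
    set g := f - c • (1 : Module.End K V) with hg
    have hga : g = Polynomial.aeval f (Polynomial.X - Polynomial.C c) := by
      rw [map_sub, Polynomial.aeval_X, Polynomial.aeval_C, hg, Algebra.algebraMap_eq_smul_one]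
    have hgW : ∀ x ∈ W, g x ∈ W := fun x hx => W.sub_mem (hW x hx) (W.smul_mem c hx)
    have h1 : g q ∈ X := by
      apply ih (fun c hc => hl c (by simp [hc])) _ (hgW q hq)
      rw [lp_cons, mul_comm, map_mul, ← hga] at h
      exact h
    have h2 : X ≤ Submodule.map g X ⊔ (W ⊓ f.maxGenEigenspace c) := by
      rw [hX]
      refine iSup₂_le fun μ hμ => ?_
      by_cases hμc : μ = c
      · subst hμc; exact le_sup_right
      · refine le_trans ?_ le_sup_left
        rintro x ⟨hx, hx'⟩
        obtain ⟨k, hk⟩ := (Module.End.mem_maxGenEigenspace f μ x).mp hx'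
        have hfa : f - μ • (1 : Module.End K V) = Polynomial.aeval f (Polynomial.X - Polynomial.C μ) := by
          rw [map_sub, Polynomial.aeval_X, Polynomial.aeval_C, Algebra.algebraMap_eq_smul_one]
        have hcop : IsCoprime (Polynomial.X - Polynomial.C c) ((Polynomial.X - Polynomial.C μ) ^ k) :=
          (Polynomial.isCoprime_X_sub_C_of_isUnit_sub (by
            rw [isUnit_iff_ne_zero, sub_ne_zero]; exact Ne.symm hμc)).pow_right
        obtain ⟨u, v, huv⟩ := hcop
        refine ⟨Polynomial.aeval f u x, ?_, ?_⟩
        · refine Submodule.mem_iSup_of_mem μ (Submodule.mem_iSup_of_mem hμ ⟨aeval_mem f W hW u hx, ?_⟩)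
          refine (Module.End.mem_maxGenEigenspace f μ _).mpr ⟨k, ?_⟩
          rw [hfa, ← map_pow, ← Module.End.mul_apply, ← map_mul, mul_comm, map_mul, Module.End.mul_apply, map_pow,
            ← hfa, hk, map_zero]
        · have := congrArg (fun p => Polynomial.aeval f p x) huv
          simp only [map_add, map_mul, map_one, LinearMap.add_apply, Module.End.mul_apply, map_pow] at this
          rw [← map_pow, map_pow, ← hfa, hk, map_zero, add_zero] at this
          rw [← Module.End.mul_apply, hga, ← map_mul, mul_comm, map_mul, Module.End.mul_apply]
          exact this
    obtain ⟨_, ⟨y, hy, rfl⟩, w, hw, hyw⟩ := Submodule.mem_sup.mp (h2 h1)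
    have h3 : q - y ∈ W ⊓ f.maxGenEigenspace c := by
      refine ⟨W.sub_mem hq (hXW hy), ?_⟩
      obtain ⟨k, hk⟩ := (Module.End.mem_maxGenEigenspace f c w).mp hw.2
      refine (Module.End.mem_maxGenEigenspace f c _).mpr ⟨k+1, ?_⟩
      rw [pow_succ, Module.End.mul_apply, ← hg, map_sub, ← hyw, add_sub_cancel_left, ← hk]
    have h4 : q - y ∈ X := (le_iSup₂ (f := fun c _ => W ⊓ f.maxGenEigenspace c) c hc) h3
    have := X.add_mem h4 hy
    rwa [sub_add_cancel] at this

end GW1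

section GW2
variable {K : Type*} [Field K] [CharZero K] {n : ℕ}
variable {M : Type*} [AddCommGroup M] [Module K M] [Module (In K n) M] [IsScalarTower K (In K n) M]

/-- representation -/
noncomputable def rho (K : Type*) [Field K] [CharZero K] {n : ℕ} (M : Type*) [AddCommGroup M] [Module K M]
    [Module (In K n) M] [IsScalarTower K (In K n) M] : In K n →ₐ[K] Module.End K M := Algebra.lsmul K K M

lemma rho_apply (a : In K n) (m : M) : rho K M a m = a • m := rfl

lemma rho_sub (a : In K n) (c : K) : rho K M a - c • (1 : Module.End K M) = rho K M (a - algebraMap K _ c) := by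
  rw [map_sub, AlgHom.commutes, Algebra.algebraMap_eq_smul_one]

lemma mem_mge {a : In K n} {c : K} {m : M} : m ∈ (rho K M a).maxGenEigenspace c ↔
    ∃ k : ℕ, (a - algebraMap K _ c) ^ k • m = 0 := by
  rw [Module.End.mem_maxGenEigenspace, rho_sub]
  simp only [← map_pow, rho_apply]

lemma gws_eq (μ : Fin n → K) :
    genWeightSpace K n M μ = ⨅ i, (rho K M (HEl K n i)).maxGenEigenspace (μ i) := by
  ext m
  rw [Submodule.mem_iInf]
  simp only [mem_mge]
  constructor
  · rintro ⟨N, hN⟩ i; exact ⟨N, hN i⟩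
  · intro h
    choose k hk using h
    refine ⟨∑ i, k i, fun i => ?_⟩
    obtain ⟨s, hs⟩ := Nat.exists_eq_add_of_le (Finset.single_le_sum (f := k) (fun _ _ => Nat.zero_le _)
      (Finset.mem_univ i))
    rw [hs, add_comm, pow_add, mul_smul, hk, smul_zero]

lemma gws_indep : iSupIndep (fun μ : Fin n → K => genWeightSpace K n M μ) := by
  simp only [gws_eq]
  apply Module.End.independent_iInf_maxGenEigenspace_of_forall_mapsTo
  intro i j φ
  apply Module.End.mapsTo_maxGenEigenspace_of_comm
  show Commute _ _
  exact (comm_HH j i).map (rho K M)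

lemma FinC_of {lam : Fin n → K} (hgw : IsGenWeightModule K n M) (hs : supp K n M ⊆ orbitOf K n lam) :
    FinC lam M := by
  intro i q
  have htop : q ∈ ⨆ μ : Fin n → K, genWeightSpace K n M μ := by
    letI := Classical.decEq (Fin n → K)
    have := DirectSum.IsInternal.submodule_iSup_eq_top hgw
    rw [this]; trivial
  induction htop using Submodule.iSup_induction' with
  | zero => exact ⟨[], by simp, smul_zero _⟩
  | add x y _ _ hx hy =>
    obtain ⟨l, hl, hx⟩ := hx
    obtain ⟨l', hl', hy⟩ := hy
    refine ⟨l ++ l', ?_, ?_⟩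
    · intro c hc
      rcases List.mem_append.mp hc with h | h
      · exact hl c h
      · exact hl' c h
    · rw [lp_append, smul_add, map_mul, mul_smul _ _ y, hy, smul_zero, add_zero, ← map_mul, mul_comm, map_mul,
        mul_smul, hx, smul_zero]
  | mem μ x hx =>
    by_cases h0 : x = 0
    · subst h0; exact ⟨[], by simp, smul_zero _⟩
    · have hμ : μ ∈ orbitOf K n lam := hs (by
        intro h; rw [h] at hx; exact h0 (by simpa using hx))
      obtain ⟨N, hN⟩ := hx
      refine ⟨List.replicate N (μ i), ?_, ?_⟩
      · intro c hc
        rw [List.eq_of_mem_replicate hc]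
        obtain ⟨z, hz⟩ := hμ i
        exact ⟨z, by rw [← hz]; ring⟩
      · rw [lp, List.map_replicate, List.prod_replicate, map_pow, map_sub, Polynomial.aeval_X, Polynomial.aeval_C]
        exact hN i

lemma FinC.top_le {lam : Fin n → K} (h : FinC lam M) (m : M) :
    m ∈ ⨆ μ ∈ orbitOf K n lam, genWeightSpace K n M μ := by
  have key : ∀ s : Finset (Fin n), m ∈ ⨆ μ ∈ orbitOf K n lam,
      ⨅ i ∈ s, (rho K M (HEl K n i)).maxGenEigenspace (μ i) := by
    intro s
    induction s using Finset.induction_on with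
    | empty =>
      refine Submodule.mem_iSup_of_mem lam (Submodule.mem_iSup_of_mem ?_ (by simp))
      intro i; exact ⟨0, by simp⟩
    | insert i s his ih =>
      refine SetLike.le_def.mp (iSup₂_le fun μ hμ => ?_) ih
      intro q hq
      set W := ⨅ i ∈ s, (rho K M (HEl K n i)).maxGenEigenspace (μ i) with hWdef
      have hW : ∀ x ∈ W, rho K M (HEl K n i) x ∈ W := by
        intro x hx
        rw [hWdef, mem_iInf2] at hx ⊢
        intro j hj
        exact Module.End.mapsTo_maxGenEigenspace_of_comm ((comm_HH j i).map (rho K M)) _ (hx j hj)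
      obtain ⟨l, hl, hlq⟩ := h i q
      have := single_dec (rho K M (HEl K n i)) W hW {c | ∃ z : ℤ, c = lam i + z} l hl q hq (by
        rw [Polynomial.aeval_algHom_apply]; exact hlq)
      refine SetLike.le_def.mp (iSup₂_le fun c hc => ?_) this
      refine le_trans ?_ (le_iSup₂ (f := fun (μ : Fin n → K) (_ : μ ∈ orbitOf K n lam) => 
        ⨅ j ∈ insert i s, (rho K M (HEl K n j)).maxGenEigenspace (μ j)) (Function.update μ i c) ?_)
      · refine le_iInf₂ fun j hj => ?_
        by_cases hji : j = i
        · subst hji; rw [Function.update_self]; exact inf_le_right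
        · rw [Function.update_of_ne hji]
          exact inf_le_left.trans (iInf₂_le j (Finset.mem_of_mem_insert_of_ne hj hji))
      · intro j
        by_cases hji : j = i
        · subst hji; rw [Function.update_self]; obtain ⟨z, hz⟩ := hc; exact ⟨z, by rw [hz]; ring⟩
        · rw [Function.update_of_ne hji]; exact hμ j
  have := key Finset.univ
  simpa [gws_eq] using this

lemma FinC.gw {lam : Fin n → K} (h : FinC lam M) : IsGenWeightModule K n M := by
  unfold IsGenWeightModule
  letI := Classical.decEq (Fin n → K)
  rw [DirectSum.isInternal_submodule_iff_iSupIndep_and_iSup_eq_top]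
  refine ⟨gws_indep, eq_top_iff.mpr fun m _ => ?_⟩
  exact SetLike.le_def.mp (iSup₂_le fun μ _ => le_iSup (fun μ => genWeightSpace K n M μ) μ) (h.top_le m)

lemma FinC.supp {lam : Fin n → K} (h : FinC lam M) : supp K n M ⊆ orbitOf K n lam := by
  intro μ hμ
  by_contra hn
  apply hμ
  rw [eq_bot_iff]
  intro m hm
  have h1 := gws_indep (K := K) (n := n) (M := M) μ
  refine (Submodule.disjoint_def.mp h1) m hm ?_
  refine SetLike.le_def.mp (iSup₂_le fun ν hν => ?_) (h.top_le m)
  exact le_iSup₂ (f := fun ν (_ : ν ≠ μ) => genWeightSpace K n M ν) ν (by rintro rfl; exact hn hν)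

end GW2

section Dec
variable {K : Type*} [Field K] [CharZero K] {n : ℕ}
variable {M : Type*} [AddCommGroup M] [Module K M] [Module (In K n) M] [IsScalarTower K (In K n) M]

/-- canonical component -/
noncomputable def MD (K : Type*) [Field K] [CharZero K] {n : ℕ} (M : Type*) [AddCommGroup M] [Module K M]
    [Module (In K n) M] [IsScalarTower K (In K n) M] (D : Set (Fin n)) : Submodule (In K n) M :=
  (⨅ i ∈ D, LL K M i) ⊓ ⨅ i ∈ Dᶜ, EE K M i

lemma mem_MD {D : Set (Fin n)} {m : M} : m ∈ MD K M D ↔ (∀ i ∈ D, m ∈ LL K M i) ∧ ∀ i ∉ D, m ∈ EE K M i := by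
  simp [MD, Submodule.mem_iInf]

lemma MD_top {lam : Fin n → K} (h : FinC lam M) : ⨆ D : Set (Fin n), MD K M D = (⊤ : Submodule (In K n) M) := by
  classical
  rw [eq_top_iff]
  have key : ∀ s : Finset (Fin n), (⊤ : Submodule (In K n) M) ≤ ⨆ D : Set (Fin n),
      (⨅ i ∈ s, (if i ∈ D then LL K M i else EE K M i)) := by
    intro s
    induction s using Finset.induction_on with
    | empty => simp
    | insert i s his ih =>
      refine ih.trans (iSup_le fun D => ?_)
      set W := ⨅ i ∈ s, (if i ∈ D then LL K M i else EE K M i)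
      intro m hm
      obtain ⟨a, h1, h2⟩ := LL_EE_sup h i m
      have hm' : m = a • m + (1 - a) • m := by rw [← add_smul]; simp
      rw [hm']
      refine Submodule.add_mem _ ?_ ?_
      · refine Submodule.mem_iSup_of_mem (insert i D) ?_
        rw [mem_iInf2]
        intro j hj
        by_cases hji : j = i
        · subst hji; simpa using h1
        · have := (mem_iInf2 _).mp hm j (Finset.mem_of_mem_insert_of_ne hj hji)
          simp only [Set.mem_insert_iff, hji, false_or]
          exact Submodule.smul_mem _ _ this
      · refine Submodule.mem_iSup_of_mem (D \ {i}) ?_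
        rw [mem_iInf2]
        intro j hj
        by_cases hji : j = i
        · subst hji; simpa using h2
        · have := (mem_iInf2 _).mp hm j (Finset.mem_of_mem_insert_of_ne hj hji)
          simp only [Set.mem_diff, Set.mem_singleton_iff, hji, not_false_eq_true, and_true]
          exact Submodule.smul_mem _ _ this
  refine (key Finset.univ).trans (iSup_mono fun D => ?_)
  intro m hm
  rw [mem_MD]
  simp only [Finset.mem_univ, iInf_pos, Submodule.mem_iInf] at hm
  exact ⟨fun i hi => by simpa [hi] using hm i, fun i hi => by simpa [hi] using hm i⟩

lemma MD_indep : iSupIndep (MD K M : Set (Fin n) → Submodule (In K n) M) := by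
  classical
  rw [iSupIndep_iff_finsetSum_eq_zero_imp_eq_zero]
  intro t v hv hv0 D0 hD0
  -- reduce to sums
  have main : ∀ f : Set (Fin n) → M, (∀ D, f D ∈ MD K M D) → ∑ D, f D = 0 → ∀ D, f D = 0 := by
    intro f hf hs D0
    have key : ∀ s : Finset (Fin n), ∑ D with (∀ i ∈ s, (i ∈ D ↔ i ∈ D0)), f D = 0 := by
      intro s
      induction s using Finset.induction_on with
      | empty => simpa using hs
      | insert i s his ih =>
        have hsplit := Finset.sum_filter_add_sum_filter_not
          (Finset.univ.filter fun D : Set (Fin n) => ∀ i ∈ s, (i ∈ D ↔ i ∈ D0)) (fun D => i ∈ D) f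
        rw [ih] at hsplit
        have hL : ∑ D ∈ (Finset.univ.filter fun D : Set (Fin n) => ∀ i ∈ s, (i ∈ D ↔ i ∈ D0)) with i ∈ D, f D
            ∈ LL K M i := Submodule.sum_mem _ fun D hD => (mem_MD.mp (hf D)).1 i (Finset.mem_filter.mp hD).2
        have hE : ∑ D ∈ (Finset.univ.filter fun D : Set (Fin n) => ∀ i ∈ s, (i ∈ D ↔ i ∈ D0)) with ¬ i ∈ D, f D
            ∈ EE K M i := Submodule.sum_mem _ fun D hD => (mem_MD.mp (hf D)).2 i (Finset.mem_filter.mp hD).2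
        have hL0 := (Submodule.disjoint_def.mp (LL_EE_disj (K := K) (M := M) i)) _ hL (by
          rw [eq_neg_of_add_eq_zero_left hsplit]; exact Submodule.neg_mem _ hE)
        have hE0 := hsplit
        rw [hL0, zero_add] at hE0
        by_cases hi : i ∈ D0
        · rw [← hL0, Finset.filter_filter]
          apply Finset.sum_congr _ fun _ _ => rfl
          ext D; simp [Finset.forall_mem_insert, hi, and_comm]
        · rw [← hE0, Finset.filter_filter]
          apply Finset.sum_congr _ fun _ _ => rfl
          ext D; simp [Finset.forall_mem_insert, hi, and_comm]
    have := key Finset.univ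
    rw [Finset.sum_eq_single D0] at this
    · exact this
    · intro D hD hne
      exfalso; apply hne
      ext i; exact (Finset.mem_filter.mp hD).2 i (Finset.mem_univ i)
    · simp
  have := main (fun D => if D ∈ t then v D else 0) (by
    intro D
    by_cases hD : D ∈ t
    · simp only [hD, if_true]; exact hv D hD
    · simp [hD]) (by rw [Finset.sum_ite_mem, Finset.univ_inter]; exact hv0) D0
  simpa [hD0] using this

end Dec

section Typ
variable {K : Type*} [Field K] [CharZero K] {n : ℕ}
variable {M : Type*} [AddCommGroup M] [Module K M] [Module (In K n) M] [IsScalarTower K (In K n) M]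

/-- modules of type D -/
structure Ty (lam : Fin n → K) (D : Set (Fin n)) (M : Type*) [AddCommGroup M] [Module K M]
    [Module (In K n) M] : Prop where
  nil : ∀ i ∈ D, ∀ q : M, ∃ k : ℕ, dEl K n i ^ k • q = 0
  kill : ∀ i ∉ D, ∀ q : M, eE K n i • q = 0
  fin : FinC lam M

lemma Ty.sub {lam : Fin n → K} {D : Set (Fin n)} (h : Ty lam D M) (p : Submodule (In K n) M) : Ty lam D p where
  nil := fun i hi q => by
    obtain ⟨k, hk⟩ := h.nil i hi q
    exact ⟨k, Subtype.ext hk⟩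
  kill := fun i hi q => Subtype.ext (h.kill i hi q)
  fin := h.fin.sub p

lemma Ty.quot {lam : Fin n → K} {D : Set (Fin n)} (h : Ty lam D M) (p : Submodule (In K n) M) : Ty lam D (M ⧸ p) where
  nil := fun i hi q => by
    obtain ⟨q, rfl⟩ := Submodule.Quotient.mk_surjective p q
    obtain ⟨k, hk⟩ := h.nil i hi q
    exact ⟨k, by rw [← Submodule.Quotient.mk_smul, hk, Submodule.Quotient.mk_zero]⟩
  kill := fun i hi q => by
    obtain ⟨q, rfl⟩ := Submodule.Quotient.mk_surjective p q
    rw [← Submodule.Quotient.mk_smul, h.kill i hi q, Submodule.Quotient.mk_zero]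
  fin := h.fin.quot p

lemma MD_Ty {lam : Fin n → K} (h : FinC lam M) (D : Set (Fin n)) : Ty lam D (MD K M D) where
  nil := fun i hi q => by
    obtain ⟨k, hk⟩ := (mem_MD.mp q.2).1 i hi
    exact ⟨k, Subtype.ext hk⟩
  kill := fun i hi q => Subtype.ext (by
    have := (mem_MD.mp q.2).2 i hi 0
    rwa [pow_zero, mul_one] at this)
  fin := h.sub _

lemma sE_inj {i : Fin n} {k : ℤ} {w : M} (h : 0 ≤ k ∨ ∀ q : M, eE K n i • q = 0) (hw : sE K n i k • w = 0) :
    w = 0 := by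
  have h1 : ∀ k : ℕ, sE K n i (k : ℤ) • w = 0 → w = 0 := by
    intro k hk
    have := congrArg (fun x => dEl K n i ^ k • x) hk
    simpa only [smul_zero, sE_nat, ← mul_smul, dk_intk, one_smul] using this
  rcases le_or_gt 0 k with hk | hk
  · obtain ⟨m, rfl⟩ := Int.eq_ofNat_of_zero_le hk
    exact h1 m hw
  · rcases h with h | h
    · omega
    obtain ⟨m, rfl⟩ := Int.exists_eq_neg_ofNat hk.le
    rw [sE_neg] at hw
    clear hk
    induction m with
    | zero => simpa using hw
    | succ m ih =>
      apply ih
      rw [pow_succ', mul_smul] at hw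
      have := congrArg (fun x => intEl K n i • x) hw
      simpa only [smul_zero, ← mul_smul _ (dEl K n i), int_d, sub_smul, one_smul, h, sub_zero] using this

lemma comm_aeval {a h : In K n} (hc : Commute a h) (p : Polynomial K) : Commute a (Polynomial.aeval h p) := by
  induction p using Polynomial.induction_on' with
  | add p q hp hq => rw [map_add]; exact hp.add_right hq
  | monomial k r =>
    rw [Polynomial.aeval_monomial]
    exact (show Commute a _ from (Algebra.commutes r a).symm).mul_right (hc.pow_right k)

lemma list_eig {h : In K n} {v : M} (hv : v ≠ 0) (l : List K) (hl : Polynomial.aeval h (lp l) • v = 0) :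
    ∃ c ∈ l, ∃ p : Polynomial K, Polynomial.aeval h p • v ≠ 0 ∧
      h • Polynomial.aeval h p • v = c • Polynomial.aeval h p • v := by
  induction l with
  | nil => rw [lp_nil, map_one, one_smul] at hl; exact absurd hl hv
  | cons c l ih =>
    by_cases h0 : Polynomial.aeval h (lp l) • v = 0
    · obtain ⟨c', hc', r⟩ := ih h0
      exact ⟨c', by simp [hc'], r⟩
    · refine ⟨c, by simp, lp l, h0, ?_⟩
      rw [lp_cons, map_mul, mul_smul, map_sub, Polynomial.aeval_X, Polynomial.aeval_C, sub_smul, algebraMap_smul,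
        sub_eq_zero] at hl
      exact hl

lemma Ty.exists_vec {lam : Fin n → K} {D : Set (Fin n)} (h : Ty lam D M) [Nontrivial M] :
    ∃ v : M, v ≠ 0 ∧ (∀ i ∈ D, dEl K n i • v = 0) ∧ (∀ i ∉ D, HEl K n i • v = lam i • v) := by
  have key : ∀ s : Finset (Fin n), ∃ v : M, v ≠ 0 ∧ (∀ i ∈ s, i ∈ D → dEl K n i • v = 0) ∧
      (∀ i ∈ s, i ∉ D → HEl K n i • v = lam i • v) := by
    intro s
    induction s using Finset.induction_on with
    | empty =>
      obtain ⟨v, hv⟩ := exists_ne (0 : M)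
      exact ⟨v, hv, by simp, by simp⟩
    | insert i s his ih =>
      obtain ⟨v, hv, h1, h2⟩ := ih
      have step : ∀ a : In K n, (∀ j, j ≠ i → Commute (dEl K n j) a) → (∀ j, j ≠ i → Commute (HEl K n j) a) →
          a • v ≠ 0 → (i ∈ D → dEl K n i • a • v = 0) → (i ∉ D → HEl K n i • a • v = lam i • a • v) →
          ∃ v : M, v ≠ 0 ∧ (∀ j ∈ insert i s, j ∈ D → dEl K n j • v = 0) ∧
      (∀ j ∈ insert i s, j ∉ D → HEl K n j • v = lam j • v) := by
        intro a c1 c2 ha a1 a2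
        refine ⟨a • v, ha, fun j hj hjD => ?_, fun j hj hjD => ?_⟩
        · by_cases hji : j = i
          · subst hji; exact a1 hjD
          · rw [← mul_smul, (c1 j hji).eq, mul_smul, h1 j (Finset.mem_of_mem_insert_of_ne hj hji) hjD, smul_zero]
        · by_cases hji : j = i
          · subst hji; exact a2 hjD
          · rw [← mul_smul, (c2 j hji).eq, mul_smul, h2 j (Finset.mem_of_mem_insert_of_ne hj hji) hjD,
              ← smul_comm]
      by_cases hi : i ∈ D
      · classical
        have hex := h.nil i hi v
        have h0 : Nat.find hex ≠ 0 := by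
          intro h0
          have := Nat.find_spec hex
          rw [h0, pow_zero, one_smul] at this
          exact hv this
        obtain ⟨k, hk⟩ := Nat.exists_eq_succ_of_ne_zero h0
        have hs := Nat.find_spec hex
        refine step (dEl K n i ^ k) (fun j hj => (comm_dd hj).pow_right k) (fun j hj => (comm_Hd hj).pow_right k)
          (Nat.find_min hex (by omega)) (fun _ => ?_) (fun h => absurd hi h)
        rw [← mul_smul, ← pow_succ']
        rwa [hk] at hs
      · obtain ⟨l, hl, hlv⟩ := h.fin i v
        obtain ⟨c, hc, p, hp, he⟩ := list_eig hv l hlv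
        obtain ⟨z, hz⟩ := hl c hc
        refine step (sE K n i (-z) * Polynomial.aeval (HEl K n i) p)
          (fun j hj => (comm_d_sE hj _).mul_right (comm_aeval (comm_Hd hj.symm).symm p))
          (fun j hj => (comm_H_sE hj _).mul_right (comm_aeval (comm_HH _ _) p)) ?_ (fun h => absurd h hi) (fun _ => ?_)
        · rw [mul_smul]
          intro h0
          exact hp (sE_inj (Or.inr (h.kill i hi)) h0)
        · rw [mul_smul, ← mul_smul (HEl K n i), H_sE, mul_smul, add_smul, he, hz,
            ← algebraMap_smul (R := K) (In K n) (lam i + z), ← add_smul, ← mul_smul, ← mul_smul, ← mul_smul,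
            ← map_intCast (algebraMap K (In K n)), ← map_add]
          rw [Int.cast_neg, add_neg_cancel_right, ← Algebra.commutes, mul_assoc, mul_smul, algebraMap_smul]
  obtain ⟨v, hv, h1, h2⟩ := key Finset.univ
  exact ⟨v, hv, fun i => h1 i (Finset.mem_univ i), fun i => h2 i (Finset.mem_univ i)⟩

end Typ

section Std
variable {K : Type*} [Field K] [CharZero K] {n : ℕ}
variable {M : Type*} [AddCommGroup M] [Module K M] [Module (In K n) M] [IsScalarTower K (In K n) M]

lemma b_d (v : M) (i : Fin n) (z : Fin n → ℤ) : dEl K n i • sh K n z • v = sh K n (Function.update z i (z i - 1)) • v := by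
  rw [← mul_smul, d_sh]

lemma b_zero {v : M} {i : Fin n} (hv : dEl K n i • v = 0) {z : Fin n → ℤ} (hz : z i < 0) : sh K n z • v = 0 := by
  rw [sh_d i z hz, mul_smul, hv, smul_zero]

lemma b_int {D : Set (Fin n)} (hk : ∀ i ∉ D, ∀ q : M, eE K n i • q = 0) (v : M) (i : Fin n) {z : Fin n → ℤ}
    (hz : i ∈ D → 0 ≤ z i) : intEl K n i • sh K n z • v = sh K n (Function.update z i (z i + 1)) • v := by
  by_cases hi : i ∈ D
  · rw [← mul_smul, int_sh i z (hz hi)]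
  · rw [← mul_smul, int_sh_neg, sub_smul, mul_smul, hk i hi, sub_zero]

lemma b_H {v : M} {i : Fin n} {c : K} (hv : HEl K n i • v = c • v) (z : Fin n → ℤ) :
    HEl K n i • sh K n z • v = (c + (z i : K)) • sh K n z • v := by
  rw [← mul_smul, H_sh, mul_smul, add_smul, hv, ← map_intCast (algebraMap K (In K n)), algebraMap_smul, ← add_smul,
    ← smul_comm]

lemma b_ne {D : Set (Fin n)} (hk : ∀ i ∉ D, ∀ q : M, eE K n i • q = 0) {v : M} (hv : v ≠ 0) {z : Fin n → ℤ}
    (hz : ∀ i ∈ D, 0 ≤ z i) : sh K n z • v ≠ 0 := by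
  have key : ∀ s : Finset (Fin n), ∀ z : Fin n → ℤ, (∀ i ∈ D, 0 ≤ z i) → (∀ i ∉ s, z i = 0) → sh K n z • v ≠ 0 := by
    intro s
    induction s using Finset.induction_on with
    | empty =>
      intro z _ hz
      have : z = 0 := by ext i; exact hz i (by simp)
      rw [this, sh_zero, one_smul]; exact hv
    | insert i s his ih =>
      intro z hz hzs h0
      have e1 : shr K n i z = sh K n (Function.update z i 0) := by rw [sh_update, sE_zero, one_mul]
      rw [sh_eq i z, mul_smul, e1] at h0
      refine ih (Function.update z i 0) ?_ ?_ (sE_inj ?_ h0)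
      · intro j hj
        by_cases hji : j = i
        · subst hji; simp
        · rw [Function.update_of_ne hji]; exact hz j hj
      · intro j hj
        by_cases hji : j = i
        · subst hji; simp
        · rw [Function.update_of_ne hji]; exact hzs j (by simp [hji, hj])
      · by_cases hi : i ∈ D
        · exact Or.inl (hz i hi)
        · exact Or.inr (hk i hi)
  exact key Finset.univ z hz (by simp)

/-- index set of the standard basis -/
abbrev ZD (D : Set (Fin n)) : Type := {z : Fin n → ℤ // ∀ i ∈ D, 0 ≤ z i}

lemma std_basis {D : Set (Fin n)} (hk : ∀ i ∉ D, ∀ q : M, eE K n i • q = 0) {v : M} (hv : v ≠ 0)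
    (hd : ∀ i ∈ D, dEl K n i • v = 0) {μ : Fin n → K} (hH : ∀ i, HEl K n i • v = μ i • v)
    (hgen : ∀ N : Submodule (In K n) M, v ∈ N → N = ⊤) :
    ∃ B : Module.Basis (ZD D) K M, ∀ z, B z = sh K n z.1 • v := by
  have hli : LinearIndependent K (fun z : ZD D => sh K n z.1 • v) := by
    have hinj : Function.Injective (fun z : ZD D => (fun i => μ i + (z.1 i : K))) := by
      intro z w h
      apply Subtype.ext
      ext i
      have := congrFun h i
      simpa using this
    refine iSupIndep.linearIndependent _ ((gws_indep (K := K) (n := n) (M := M)).comp hinj) (fun z => ?_)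
      (fun z => b_ne hk hv z.2)
    refine ⟨1, fun i => ?_⟩
    rw [pow_one, sub_smul, b_H (hH i), algebraMap_smul, sub_self]
  have hmem : ∀ z : Fin n → ℤ, sh K n z • v ∈ Submodule.span K (Set.range (fun z : ZD D => sh K n z.1 • v)) := by
    intro z
    by_cases hz : ∀ i ∈ D, 0 ≤ z i
    · exact Submodule.subset_span ⟨⟨z, hz⟩, rfl⟩
    · push Not at hz
      obtain ⟨i, hi, hz⟩ := hz
      rw [b_zero (hd i hi) hz]; exact Submodule.zero_mem _
  have stab : ∀ a : In K n, (∀ z : ZD D, a • sh K n z.1 • v ∈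
      Submodule.span K (Set.range (fun z : ZD D => sh K n z.1 • v))) →
      ∀ m ∈ Submodule.span K (Set.range (fun z : ZD D => sh K n z.1 • v)), a • m ∈
      Submodule.span K (Set.range (fun z : ZD D => sh K n z.1 • v)) := by
    intro a ha m hm
    induction hm using Submodule.span_induction with
    | mem x hx => obtain ⟨z, rfl⟩ := hx; exact ha z
    | zero => rw [smul_zero]; exact Submodule.zero_mem _
    | add x y _ _ hx hy => rw [smul_add]; exact Submodule.add_mem _ hx hy
    | smul c x _ hx => rw [← smul_comm]; exact Submodule.smul_mem _ c hx
  let N : Submodule (In K n) M := toSub (Submodule.span K (Set.range (fun z : ZD D => sh K n z.1 • v)))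
    (fun i => stab _ fun z => by rw [b_d]; exact hmem _)
    (fun i => stab _ fun z => by rw [b_int hk v i (z.2 i)]; exact hmem _)
    (fun i => stab _ fun z => by rw [b_H (hH i)]; exact Submodule.smul_mem _ _ (hmem _))
  have hN : N = ⊤ := hgen N (by
    show v ∈ Submodule.span K (Set.range (fun z : ZD D => sh K n z.1 • v))
    have := hmem 0
    rwa [sh_zero, one_smul] at this)
  refine ⟨Module.Basis.mk hli (fun m _ => ?_), fun z => by rw [Module.Basis.mk_apply]⟩
  have : m ∈ N := by rw [hN]; trivial
  exact this

end Std

section NForm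
universe w
variable {K : Type*} [Field K] [CharZero K] {n : ℕ}
variable {M : Type w} [AddCommGroup M] [Module K M] [Module (In K n) M] [IsScalarTower K (In K n) M]

/-- polynomial in the H -/
noncomputable def hp (K : Type*) [Field K] [CharZero K] (n : ℕ) (c : MvPolynomial (Fin n) K) : In K n :=
  dnVal K n (MvPolynomial.aeval (HElD K n) c)

lemma hp_add (c c' : MvPolynomial (Fin n) K) : hp K n (c + c') = hp K n c + hp K n c' := by simp [hp]
lemma hp_mul (c c' : MvPolynomial (Fin n) K) : hp K n (c * c') = hp K n c * hp K n c' := by simp [hp]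
lemma hp_one : hp K n 1 = 1 := by simp [hp]
lemma hp_zero : hp K n 0 = 0 := by simp [hp]
lemma hp_C (r : K) : hp K n (MvPolynomial.C r) = algebraMap K _ r := by
  rw [hp, MvPolynomial.aeval_C]; rfl
lemma hp_X (i : Fin n) : hp K n (MvPolynomial.X i) = HEl K n i := by
  rw [hp, MvPolynomial.aeval_X]; rfl
lemma hp_smul (r : K) (c : MvPolynomial (Fin n) K) : hp K n (r • c) = r • hp K n c := by
  rw [MvPolynomial.smul_eq_C_mul, hp_mul, hp_C, Algebra.smul_def]

lemma hp_mem (W : Submodule K M) (hW : ∀ i, ∀ x ∈ W, HEl K n i • x ∈ W) (c : MvPolynomial (Fin n) K) {x : M}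
    (hx : x ∈ W) : hp K n c • x ∈ W := by
  induction c using MvPolynomial.induction_on generalizing x with
  | C r => rw [hp_C, algebraMap_smul]; exact W.smul_mem r hx
  | add p q hp hq => rw [hp_add, add_smul]; exact W.add_mem (hp hx) (hq hx)
  | mul_X p i ih => rw [hp_mul, hp_X, mul_smul]; exact ih (hW i x hx)

lemma hp_eval {v : M} {μ : Fin n → K} (hv : ∀ i, HEl K n i • v = μ i • v) (c : MvPolynomial (Fin n) K) :
    hp K n c • v = MvPolynomial.eval μ c • v := by
  induction c using MvPolynomial.induction_on with
  | C r => rw [hp_C, algebraMap_smul, MvPolynomial.eval_C]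
  | add p q hp hq => rw [hp_add, add_smul, hp, hq, map_add, add_smul]
  | mul_X p i ih => rw [hp_mul, hp_X, mul_smul, hv, ← smul_comm, ih, map_mul, MvPolynomial.eval_X, smul_smul, mul_comm]

/-- admissible vectors -/
def Adm (K : Type*) [Field K] [CharZero K] {n : ℕ} (M : Type w) [AddCommGroup M] [Module K M]
    [Module (In K n) M] [IsScalarTower K (In K n) M] (D : Set (Fin n)) : Submodule K M where
  carrier := {v | ∀ i ∈ D, dEl K n i • v = 0}
  add_mem' := by intro a b ha hb i hi; rw [smul_add, ha i hi, hb i hi, add_zero]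
  zero_mem' := fun i _ => smul_zero _
  smul_mem' := by intro c v hv i hi; rw [← smul_comm, hv i hi, smul_zero]

lemma mem_Adm {D : Set (Fin n)} {v : M} : v ∈ Adm K M D ↔ ∀ i ∈ D, dEl K n i • v = 0 := Iff.rfl

lemma Adm_H {D : Set (Fin n)} (j : Fin n) {v : M} (hv : v ∈ Adm K M D) : HEl K n j • v ∈ Adm K M D := by
  intro i hi
  by_cases h : j = i
  · subst h
    have : dEl K n j * HEl K n j = (HEl K n j + 1) * dEl K n j := by rw [add_mul, H_d, one_mul]; abel
    rw [← mul_smul, this, mul_smul, hv j hi, smul_zero]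
  · rw [← mul_smul, ← (comm_Hd h).eq, mul_smul, hv i hi, smul_zero]

lemma Adm_H_one {D : Set (Fin n)} {v : M} (hv : v ∈ Adm K M D) {i : Fin n} (hi : i ∈ D) : HEl K n i • v = v := by
  rw [H_sub_one, add_smul, one_smul, mul_smul, hv i hi, smul_zero, add_zero]

/-- evaluation of a normal form -/
noncomputable def Phi (v : M) : ((Fin n → ℤ) →₀ MvPolynomial (Fin n) K) →ₗ[K] M :=
  Finsupp.lsum K fun z =>
    { toFun := fun c => sh K n z • hp K n c • v
      map_add' := fun c c' => by rw [hp_add, add_smul, smul_add]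
      map_smul' := fun r c => by rw [hp_smul, smul_assoc, ← smul_comm, RingHom.id_apply] }

lemma Phi_single (v : M) (z : Fin n → ℤ) (c : MvPolynomial (Fin n) K) :
    Phi v (Finsupp.single z c) = sh K n z • hp K n c • v := by
  rw [Phi, Finsupp.lsum_single]; rfl

lemma Phi_sum (v : M) (f : (Fin n → ℤ) →₀ MvPolynomial (Fin n) K) :
    Phi v f = ∑ z ∈ f.support, sh K n z • hp K n (f z) • v := rfl

/-- normal form relation -/
def NF (D : Set (Fin n)) (a : In K n) (f : (Fin n → ℤ) →₀ MvPolynomial (Fin n) K) : Prop :=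
  ∀ (Q : Type w) [AddCommGroup Q] [Module K Q] [Module (In K n) Q] [IsScalarTower K (In K n) Q],
    (∀ i ∉ D, ∀ q : Q, eE K n i • q = 0) → ∀ v ∈ Adm K Q D, a • v = Phi v f

lemma NF_step (D : Set (Fin n)) (a : In K n)
    (h : ∀ z c, ∃ g : (Fin n → ℤ) →₀ MvPolynomial (Fin n) K,
      ∀ (Q : Type w) [AddCommGroup Q] [Module K Q] [Module (In K n) Q] [IsScalarTower K (In K n) Q],
      (∀ i ∉ D, ∀ q : Q, eE K n i • q = 0) → ∀ v ∈ Adm K Q D, a • sh K n z • hp K n c • v = Phi v g)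
    (f : (Fin n → ℤ) →₀ MvPolynomial (Fin n) K) :
    ∃ g : (Fin n → ℤ) →₀ MvPolynomial (Fin n) K,
      ∀ (Q : Type w) [AddCommGroup Q] [Module K Q] [Module (In K n) Q] [IsScalarTower K (In K n) Q],
      (∀ i ∉ D, ∀ q : Q, eE K n i • q = 0) → ∀ v ∈ Adm K Q D, a • Phi v f = Phi v g := by
  induction f using Finsupp.induction_linear with
  | zero => exact ⟨0, fun Q _ _ _ _ _ v _ => by rw [map_zero, smul_zero]⟩
  | add f g hf hg =>
    obtain ⟨f', hf⟩ := hf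
    obtain ⟨g', hg⟩ := hg
    exact ⟨f' + g', fun Q _ _ _ _ hk v hv => by rw [map_add, smul_add, hf Q hk v hv, hg Q hk v hv, map_add]⟩
  | single z c =>
    obtain ⟨g, hg⟩ := h z c
    exact ⟨g, fun Q _ _ _ _ hk v hv => by rw [Phi_single, hg Q hk v hv]⟩

lemma NF_exists (D : Set (Fin n)) (a : In K n) : ∃ f, NF.{w} D a f := by
  let W : Submodule K (In K n) :=
    { carrier := {a | ∃ f, NF.{w} D a f}
      add_mem' := by
        rintro a b ⟨f, hf⟩ ⟨g, hg⟩
        exact ⟨f + g, fun Q _ _ _ _ hk v hv => by rw [add_smul, hf Q hk v hv, hg Q hk v hv, map_add]⟩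
      zero_mem' := ⟨0, fun Q _ _ _ _ _ v _ => by rw [zero_smul, map_zero]⟩
      smul_mem' := by
        rintro c a ⟨f, hf⟩
        exact ⟨c • f, fun Q _ _ _ _ hk v hv => by rw [smul_assoc, hf Q hk v hv, map_smul]⟩ }
  have hst : ∀ b : In K n, (∀ z c, ∃ g : (Fin n → ℤ) →₀ MvPolynomial (Fin n) K,
      ∀ (Q : Type w) [AddCommGroup Q] [Module K Q] [Module (In K n) Q] [IsScalarTower K (In K n) Q],
      (∀ i ∉ D, ∀ q : Q, eE K n i • q = 0) → ∀ v ∈ Adm K Q D, b • sh K n z • hp K n c • v = Phi v g) →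
      ∀ a ∈ W, b • a ∈ W := by
    rintro b hb a ⟨f, hf⟩
    obtain ⟨g, hg⟩ := NF_step D b hb f
    exact ⟨g, fun Q _ _ _ _ hk v hv => by rw [smul_eq_mul, mul_smul, hf Q hk v hv, hg Q hk v hv]⟩
  let N : Submodule (In K n) (In K n) := toSub W
    (fun i => hst _ fun z c => ⟨Finsupp.single (Function.update z i (z i - 1)) c, fun Q _ _ _ _ hk v hv => by
      rw [Phi_single, b_d]⟩)
    (fun i => hst _ fun z c => by
      by_cases hz : i ∈ D → 0 ≤ z i
      · exact ⟨Finsupp.single (Function.update z i (z i + 1)) c, fun Q _ _ _ _ hk v hv => by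
          rw [Phi_single, b_int hk _ i hz]⟩
      · push Not at hz
        refine ⟨0, fun Q _ _ _ _ hk v hv => ?_⟩
        have hu : hp K n c • v ∈ Adm K Q D := hp_mem _ (fun i x hx => Adm_H i hx) c hv
        rw [b_zero (hu i hz.1) hz.2, smul_zero, map_zero])
    (fun i => hst _ fun z c => ⟨Finsupp.single z ((MvPolynomial.X i + MvPolynomial.C (z i : K)) * c),
      fun Q _ _ _ _ hk v hv => by
        rw [Phi_single, ← mul_smul, H_sh, hp_mul, hp_add, hp_X, hp_C, map_intCast, mul_smul, mul_smul]⟩)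
  have h1 : (1 : In K n) ∈ N := ⟨Finsupp.single 0 1, fun Q _ _ _ _ hk v hv => by
    rw [Phi_single, sh_zero, hp_one, one_smul, one_smul]⟩
  have := N.smul_mem a h1
  rw [smul_eq_mul, mul_one] at this
  exact this

lemma Phi_indep {D : Set (Fin n)} (hk : ∀ i ∉ D, ∀ q : M, eE K n i • q = 0) {v : M} (hv : v ≠ 0)
    {μ : Fin n → K} (hH : ∀ i, HEl K n i • v = μ i • v) (f : (Fin n → ℤ) →₀ MvPolynomial (Fin n) K)
    (h : Phi v f = 0) (z : Fin n → ℤ) (hz : ∀ i ∈ D, 0 ≤ z i) : MvPolynomial.eval μ (f z) = 0 := by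
  by_cases hzs : z ∈ f.support
  · have hinj : Function.Injective (fun z : Fin n → ℤ => (fun i => μ i + (z i : K))) := by
      intro z w h
      ext i
      simpa using congrFun h i
    have := (iSupIndep_iff_finsetSum_eq_zero_imp_eq_zero _).mp ((gws_indep (K := K) (n := n) (M := M)).comp hinj)
      f.support (fun z => sh K n z • hp K n (f z) • v) ?_ h z hzs
    · simp only [hp_eval hH] at this
      rw [← smul_comm] at this
      rcases smul_eq_zero.mp this with h | h
      · exact h
      · exact absurd h (b_ne hk hv hz)
    · intro z _
      refine ⟨1, fun i => ?_⟩
      simp only [hp_eval hH]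
      rw [pow_one, sub_smul, algebraMap_smul, ← smul_comm _ (sh K n z), ← smul_comm _ (HEl K n i), b_H (hH i),
        smul_comm, sub_self]
  · rw [Finsupp.notMem_support_iff.mp hzs, map_zero]

open Classical in
/-- specialize the D variables to one -/
noncomputable def tau (D : Set (Fin n)) : MvPolynomial (Fin n) K →ₐ[K] MvPolynomial (Fin n) K :=
  MvPolynomial.aeval fun i => if i ∈ D then 1 else MvPolynomial.X i

lemma hp_tau {D : Set (Fin n)} (c : MvPolynomial (Fin n) K) {u : M} (hu : u ∈ Adm K M D) :
    hp K n (tau D c) • u = hp K n c • u := by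
  induction c using MvPolynomial.induction_on generalizing u with
  | C r => rw [tau, MvPolynomial.aeval_C]; rfl
  | add p q hp hq => rw [map_add, hp_add, hp_add, add_smul, add_smul, hp hu, hq hu]
  | mul_X p i ih =>
    rw [map_mul, hp_mul, hp_mul, mul_smul, mul_smul, hp_X]
    by_cases hi : i ∈ D
    · rw [Adm_H_one hu hi, tau, MvPolynomial.aeval_X, if_pos hi, hp_one, one_smul, ← tau, ih hu]
    · have : tau D (MvPolynomial.X i : MvPolynomial (Fin n) K) = MvPolynomial.X i := by
        rw [tau, MvPolynomial.aeval_X, if_neg hi]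
      rw [this, hp_X, ih (Adm_H i hu)]

open Classical in
lemma eval_tau (D : Set (Fin n)) (c : MvPolynomial (Fin n) K) (x : Fin n → K) :
    MvPolynomial.eval x (tau D c) = MvPolynomial.eval (fun i => if i ∈ D then 1 else x i) c := by
  induction c using MvPolynomial.induction_on with
  | C r => rw [tau, MvPolynomial.aeval_C, MvPolynomial.algebraMap_eq, MvPolynomial.eval_C, MvPolynomial.eval_C]
  | add p q hp hq => rw [map_add, map_add, map_add, hp, hq]
  | mul_X p i ih =>
    rw [map_mul, map_mul, map_mul, ih, MvPolynomial.eval_X, tau, MvPolynomial.aeval_X]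
    by_cases hi : i ∈ D <;> simp [hi]

end NForm

section Ann
universe w
variable {K : Type*} [Field K] [CharZero K] {n : ℕ}
variable {M : Type w} [AddCommGroup M] [Module K M] [Module (In K n) M] [IsScalarTower K (In K n) M]
variable {M' : Type w} [AddCommGroup M'] [Module K M'] [Module (In K n) M'] [IsScalarTower K (In K n) M']

lemma ann_adm {lam : Fin n → K} {D : Set (Fin n)} (h : Ty lam D M) (h' : Ty lam D M') [Nontrivial M] {a : In K n}
    (ha : a ∈ annSet K n M) (u : M') (hu : u ∈ Adm K M' D) : a • u = 0 := by
  classical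
  obtain ⟨f, hf⟩ := NF_exists.{w} D a
  obtain ⟨v, hv, hd, hH⟩ := h.exists_vec
  have key : ∀ z : Fin n → ℤ, (∀ i ∈ D, 0 ≤ z i) → tau D (f z) = 0 := by
    intro z hz
    apply MvPolynomial.funext_set (fun i => Set.range fun j : ℤ => lam i + (j : K))
      (fun i => Set.infinite_range_of_injective fun x y hxy => by simpa using hxy)
    intro x hx
    rw [map_zero, eval_tau]
    choose j hj using fun i => hx i (Set.mem_univ i)
    let j' : Fin n → ℤ := fun i => if i ∈ D then 0 else j i
    have hvj : sh K n j' • v ≠ 0 := b_ne h.kill hv (fun i hi => by simp [j', hi])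
    have hadm : sh K n j' • v ∈ Adm K M D := fun i hi => by
      rw [b_d]
      exact b_zero (hd i hi) (by simp [j', hi])
    refine Phi_indep h.kill hvj ?_ f (by rw [← hf M h.kill _ hadm, ha]) z hz
    intro i
    by_cases hi : i ∈ D
    · simp only [hi, if_true, one_smul]
      exact Adm_H_one hadm hi
    · simp only [hi, if_false]
      rw [b_H (hH i hi), ← hj i]
      simp [j', hi]
  rw [hf M' h'.kill u hu, Phi_sum]
  apply Finset.sum_eq_zero
  intro z _
  by_cases hz : ∀ i ∈ D, 0 ≤ z i
  · rw [← hp_tau (f z) hu, key z hz, hp_zero, zero_smul, smul_zero]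
  · push Not at hz
    obtain ⟨i, hi, hz⟩ := hz
    exact b_zero (hp_mem _ (fun i x hx => Adm_H i hx) (f z) hu i hi) hz

lemma ann_sub {lam : Fin n → K} {D : Set (Fin n)} (h : Ty lam D M) (h' : Ty lam D M') [Nontrivial M] :
    annSet K n M ⊆ annSet K n M' := by
  have key : ∀ s : Finset (Fin n), ∀ a ∈ annSet K n M, ∀ q : M', (∀ i ∈ D, i ∉ s → dEl K n i • q = 0) →
      a • q = 0 := by
    intro s
    induction s using Finset.induction_on with
    | empty => intro a ha q hq; exact ann_adm h h' ha q (fun i hi => hq i hi (by simp))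
    | insert i s his ih =>
      intro a ha q hq
      by_cases hi : i ∈ D
      · obtain ⟨k, hk⟩ := h'.nil i hi q
        induction k generalizing a q with
        | zero => rw [pow_zero, one_smul] at hk; rw [hk, smul_zero]
        | succ k ihk =>
          have e1 : q = intEl K n i • dEl K n i • q + eE K n i • q := by
            rw [← mul_smul, int_d, ← add_smul]; simp
          have h1 : (a * intEl K n i) • dEl K n i • q = 0 := by
            apply ihk
            · intro m; rw [mul_smul, ha]
            · intro j hj hjs
              have hji : j ≠ i := by rintro rfl; simp at hjs
              rw [← mul_smul, (comm_dd hji).eq, mul_smul, hq j hj hjs, smul_zero]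
            · rw [← mul_smul, ← pow_succ, hk]
          have h2 : a • eE K n i • q = 0 := by
            apply ih a ha
            intro j hj hjs
            by_cases hji : j = i
            · subst hji; rw [← mul_smul, d_e, zero_smul]
            · rw [← mul_smul, (comm_e_of (comm_dd hji) (comm_dint hji)).eq, mul_smul, hq j hj (by simp [hji, hjs]),
                smul_zero]
          rw [e1, smul_add, h2, add_zero, ← mul_smul]
          exact h1
      · exact ih a ha q (fun j hj hjs => hq j hj (by
          have : j ≠ i := by rintro rfl; exact hi hj
          simp [this, hjs]))
  intro a ha q
  exact key Finset.univ a ha q (by simp)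

lemma Ty.absPrime {lam : Fin n → K} {D : Set (Fin n)} (h : Ty lam D M) [Nontrivial M] : IsAbsolutelyPrime K n M := by
  refine ⟨⟨?_, ?_⟩, ?_⟩
  · intro hu
    obtain ⟨m, hm⟩ := exists_ne (0 : M)
    have : (1 : In K n) ∈ annSet K n M := by rw [hu]; trivial
    exact hm (by simpa using this m)
  · intro a b hab
    by_contra hn
    push Not at hn
    obtain ⟨ha, hb⟩ := hn
    have : ∃ m : M, b • m ≠ 0 := by
      by_contra hc
      push Not at hc
      exact hb hc
    obtain ⟨m, hm⟩ := this
    let N : Submodule (In K n) M := Submodule.span (In K n) {b • m}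
    haveI : Nontrivial N := ⟨⟨⟨b • m, Submodule.mem_span_singleton_self _⟩, 0, fun h => hm (congrArg Subtype.val h)⟩⟩
    apply ha
    apply ann_sub (h.sub N) h
    rintro ⟨x, hx⟩
    obtain ⟨r, rfl⟩ := Submodule.mem_span_singleton.mp hx
    apply Subtype.ext
    show a • r • b • m = 0
    rw [← mul_smul, ← mul_smul]
    exact hab r m
  · intro p q _ hnt
    exact Set.Subset.antisymm (ann_sub ((h.sub q).quot _) h) (ann_sub h ((h.sub q).quot _))

end Ann

section PhiMap
variable {K : Type*} [Field K] [CharZero K] {n : ℕ}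
variable {M : Type*} [AddCommGroup M] [Module K M] [Module (In K n) M] [IsScalarTower K (In K n) M]
variable {M' : Type*} [AddCommGroup M'] [Module K M'] [Module (In K n) M'] [IsScalarTower K (In K n) M']

lemma Phi_map (g : M →ₗ[In K n] M') (v : M) (f : (Fin n → ℤ) →₀ MvPolynomial (Fin n) K) :
    g (Phi v f) = Phi (g v) f := by
  rw [Phi_sum, Phi_sum, map_sum]
  apply Finset.sum_congr rfl
  intro z _
  rw [map_smul, map_smul]

lemma Phi_smul (c : K) (v : M) (f : (Fin n → ℤ) →₀ MvPolynomial (Fin n) K) :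
    Phi (c • v) f = c • Phi v f := by
  rw [Phi_sum, Phi_sum, Finset.smul_sum]
  apply Finset.sum_congr rfl
  intro z _
  rw [smul_comm c, smul_comm c]

end PhiMap

section Pmod
variable {K : Type*} [Field K] [CharZero K] {n : ℕ}

lemma P_d_one (i : Fin n) : dEl K n i • (1 : P K n) = 0 := by
  rw [dEl_smul]; simp

lemma P_H_one (i : Fin n) : HEl K n i • (1 : P K n) = (1 : K) • (1 : P K n) := by
  rw [H_sub_one, add_smul, one_smul, mul_smul, P_d_one, smul_zero, add_zero, one_smul]

lemma P_gen (N : Submodule (In K n) (P K n)) (h : (1 : P K n) ∈ N) : N = ⊤ := by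
  rw [eq_top_iff]
  intro p _
  induction p using MvPolynomial.induction_on with
  | C r =>
    have : (MvPolynomial.C r : P K n) = r • 1 := by rw [MvPolynomial.smul_eq_C_mul, mul_one]
    rw [this]
    exact N.smul_of_tower_mem r h
  | add p q hp hq => exact N.add_mem (hp trivial) (hq trivial)
  | mul_X p i ih =>
    have := N.smul_mem (xEl K n i) (ih trivial)
    rwa [xEl_smul, mul_comm] at this

end Pmod

section MslNT
universe u
variable {K : Type u} [Field K] [CharZero K]

/-- eventually zero sequences -/
def evz (K : Type u) [Field K] [CharZero K] : Submodule (In K 1) (ℕ → P K 1) where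
  carrier := {f | ∃ N, ∀ α ≥ N, f α = 0}
  add_mem' := by
    rintro f g ⟨N, hN⟩ ⟨N', hN'⟩
    refine ⟨max N N', fun α hα => ?_⟩
    rw [Pi.add_apply, hN α (le_trans (le_max_left _ _) hα), hN' α (le_trans (le_max_right _ _) hα), add_zero]
  zero_mem' := ⟨0, fun _ _ => rfl⟩
  smul_mem' := by
    rintro a f ⟨N, hN⟩
    exact ⟨N, fun α hα => by rw [Pi.smul_apply, hN α hα, smul_zero]⟩

/-- the divided powers -/
noncomputable def ww (K : Type u) [Field K] [CharZero K] : ℕ → P K 1 := fun α => intEl K 1 0 ^ α • 1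

lemma ww_H (α : ℕ) (i : Fin 1) : HEl K 1 i • ww K α = ((1 : K) + α) • ww K α := by
  obtain rfl : i = 0 := Subsingleton.elim _ _
  have := b_H (P_H_one (K := K) (n := 1) 0) (fun _ => (α : ℤ))
  have e : sh K 1 (fun _ => (α : ℤ)) = intEl K 1 0 ^ α := by
    rw [sh_eq 0, sE_nat]
    have : shr K 1 0 (fun _ => (α : ℤ)) = 1 := by
      have h2 := sh_update (K := K) (n := 1) 0 (fun _ => (α : ℤ)) 0
      rw [sE_zero, one_mul] at h2
      rw [← h2, ← sh_zero]
      congr 1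
      ext i
      obtain rfl : i = 0 := Subsingleton.elim _ _
      simp
    rw [this, mul_one]
  rw [e] at this
  simpa [ww] using this

lemma ww_ne (α : ℕ) : ww K α ≠ 0 := by
  intro h
  have := congrArg (fun x => dEl K 1 0 ^ α • x) h
  simp only [ww, ← mul_smul, dk_intk, smul_zero, one_smul] at this
  exact one_ne_zero this

lemma eEl1_eq (s t : ℕ) : eEl1 K s t = intEl K 1 0 ^ s * (eE K 1 0 * dEl K 1 0 ^ t) := by
  rw [eEl1, eE, sub_mul, one_mul, mul_sub, pow_succ, pow_succ', mul_assoc, mul_assoc]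

lemma ww_EE : (evz K).mkQ (ww K) ∈ EE K ((ℕ → P K 1) ⧸ evz K) (0 : Fin 1) := by
  intro k
  rw [← map_smul, Submodule.mkQ_apply, Submodule.Quotient.mk_eq_zero]
  refine ⟨k + 1, fun α hα => ?_⟩
  obtain ⟨m, rfl⟩ := Nat.exists_eq_add_of_le hα
  rw [Pi.smul_apply, ww, ← mul_smul, add_assoc, pow_add, mul_assoc, ← mul_assoc (dEl K 1 0 ^ k), dk_intk, one_mul,
    add_comm 1 m, pow_succ', ← mul_assoc, e_int, zero_mul, zero_smul]

lemma Msl_one_notMem (μ : K) : (1 : In K 1) ∉ MslIdeal K 1 μ := by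
  intro h
  obtain ⟨y, hy, z, hz, hyz⟩ := Submodule.mem_sup.mp h
  rw [pow_one] at hz
  obtain ⟨a, rfl⟩ := Submodule.mem_span_singleton.mp hz
  set w : (ℕ → P K 1) ⧸ evz K := (evz K).mkQ (ww K) with hw
  have hF : y • w = 0 := by
    have hle : Fideal K ≤ LinearMap.ker (LinearMap.toSpanSingleton (In K 1) _ w) := by
      rw [Fideal, Submodule.span_le]
      rintro _ ⟨s, t, rfl⟩
      show eEl1 K s t • w = 0
      rw [eEl1_eq, mul_smul, ww_EE t, smul_zero]
    exact hle hy
  have h1 : a • (HEl K 1 0 - algebraMap K _ μ) • w = w := by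
    have := congrArg (fun b => b • w) hyz
    simpa only [add_smul, hF, zero_add, smul_eq_mul, mul_smul, one_smul] using this
  let Q := EE K ((ℕ → P K 1) ⧸ evz K) (0 : Fin 1)
  let w' : Q := ⟨w, ww_EE⟩
  obtain ⟨f, hf⟩ := NF_exists.{u} (K := K) (n := 1) ∅ a
  have h2 := hf Q (by
    intro i _ q
    obtain rfl : i = 0 := Subsingleton.elim _ _
    have := q.2 0
    rw [pow_zero, mul_one] at this
    exact Subtype.ext this) ((HEl K 1 0 - algebraMap K _ μ) • w') (by intro i hi; exact absurd hi (by simp))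
  have h3 := congrArg (Submodule.subtype Q) h2
  rw [Phi_map] at h3
  have h4 : w = Phi ((HEl K 1 0 - algebraMap K _ μ) • w) f := by
    exact h1.symm.trans h3
  rw [hw, ← map_smul, ← Phi_map, Submodule.mkQ_apply, Submodule.mkQ_apply, Submodule.Quotient.eq] at h4
  obtain ⟨N, hN⟩ := h4
  have h5 : ∀ α ≥ N, ((1 : K) + α - μ) * MvPolynomial.eval (fun _ => (1 : K) + α) (f 0) = 1 := by
    intro α hα
    have h6 := hN α hα
    rw [Pi.sub_apply, sub_eq_zero] at h6
    have h7 := Phi_map (LinearMap.proj (R := In K 1) (φ := fun _ : ℕ => P K 1) α)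
      ((HEl K 1 0 - algebraMap K _ μ) • ww K) f
    rw [LinearMap.proj_apply, ← h6, LinearMap.proj_apply, Pi.smul_apply, sub_smul, ww_H, algebraMap_smul,
      ← sub_smul, Phi_smul] at h7
    have h8 : Phi (ww K α) (((1 : K) + α - μ) • f - Finsupp.single 0 1) = 0 := by
      rw [map_sub, map_smul, ← h7, Phi_single, sh_zero, hp_one, one_smul, one_smul, sub_self]
    have h9 := Phi_indep (D := Set.univ) (by simp) (ww_ne α) (ww_H α) _ h8 0 (by simp)
    rw [Finsupp.sub_apply, Finsupp.smul_apply, Finsupp.single_eq_same, map_sub, map_one, sub_eq_zero,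
      MvPolynomial.smul_eval] at h9
    exact h9
  have h10 : (MvPolynomial.X 0 - MvPolynomial.C μ) * f 0 = 1 := by
    apply MvPolynomial.funext_set (fun _ => (fun α : ℕ => (1 : K) + α) '' {α | N ≤ α})
      (fun _ => (Set.infinite_of_not_bddAbove (by
        rintro ⟨B, hB⟩
        have := hB (show B + N + 1 ∈ {α | N ≤ α} by simp; omega)
        omega)).image (by
          intro x _ y _ hxy
          simpa using hxy))
    intro x hx
    obtain ⟨α, hα, hx0⟩ := hx 0 (Set.mem_univ _)
    have hx' : x = fun _ => (1 : K) + α := by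
      ext i
      obtain rfl : i = 0 := Subsingleton.elim _ _
      exact hx0.symm
    rw [hx', map_mul, map_one, map_sub, MvPolynomial.eval_X, MvPolynomial.eval_C]
    exact h5 α hα
  have h11 := congrArg (MvPolynomial.eval (fun _ => μ)) h10
  simp at h11

/-- the generator of Msl -/
noncomputable def mv (K : Type u) [Field K] [CharZero K] (μ : K) : Msl K 1 μ := Submodule.Quotient.mk (p := MslIdeal K 1 μ) 1

lemma mv_smul (μ : K) (a : In K 1) : a • mv K μ = (Submodule.Quotient.mk (p := MslIdeal K 1 μ) a : In K 1 ⧸ MslIdeal K 1 μ) := by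
  have : a • (Submodule.Quotient.mk (p := MslIdeal K 1 μ) 1) = Submodule.Quotient.mk (p := MslIdeal K 1 μ) a := by
    rw [← Submodule.Quotient.mk_smul, smul_eq_mul, mul_one]
  exact this

lemma mv_smul_eq_zero (μ : K) (a : In K 1) (h : a ∈ MslIdeal K 1 μ) : a • mv K μ = 0 := by
  rw [mv_smul]
  exact (Submodule.Quotient.mk_eq_zero _).mpr h

lemma mv_ne (μ : K) : mv K μ ≠ 0 := fun h => Msl_one_notMem μ ((Submodule.Quotient.mk_eq_zero _).mp h)

lemma mv_gen (μ : K) (N : Submodule (In K 1) (Msl K 1 μ)) (h : mv K μ ∈ N) : N = ⊤ := by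
  rw [eq_top_iff]
  intro m _
  obtain ⟨a, ha⟩ := Submodule.Quotient.mk_surjective (MslIdeal K 1 μ) m
  have := N.smul_mem a h
  rw [mv_smul] at this
  rw [← ha]
  exact this

lemma mv_H (μ : K) (i : Fin 1) : HEl K 1 i • mv K μ = μ • mv K μ := by
  obtain rfl : i = 0 := Subsingleton.elim _ _
  have := mv_smul_eq_zero μ (HEl K 1 0 - algebraMap K _ μ) (Submodule.mem_sup_right (by
    rw [pow_one]; exact Submodule.mem_span_singleton_self _))
  rwa [sub_smul, algebraMap_smul, sub_eq_zero] at this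

lemma Msl_kill (μ : K) (i : Fin 1) (q : Msl K 1 μ) : eE K 1 i • q = 0 := by
  obtain rfl : i = 0 := Subsingleton.elim _ _
  have h1 : EE K (Msl K 1 μ) (0 : Fin 1) = ⊤ := by
    apply mv_gen
    intro k
    apply mv_smul_eq_zero
    apply Submodule.mem_sup_left
    apply Submodule.subset_span
    exact ⟨0, k, by rw [eEl1_eq, pow_zero, one_mul]⟩
  have h2 : q ∈ EE K (Msl K 1 μ) (0 : Fin 1) := by rw [h1]; trivial
  have := h2 0
  rwa [pow_zero, mul_one] at this

/-- explicit one-variable standard basis -/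
def OneB {Q : Type*} [AddCommGroup Q] [Module K Q] [Module (In K 1) Q] (p : Prop) (μ : K)
    (b : ℤ → Q) : Prop :=
  (∃ B : Module.Basis {k : ℤ // p → 0 ≤ k} K Q, ∀ k, B k = b k.1) ∧
  (∀ k, dEl K 1 0 • b k = b (k - 1)) ∧ (p → ∀ k < 0, b k = 0) ∧
  (∀ k, (p → 0 ≤ k) → intEl K 1 0 • b k = b (k + 1)) ∧
  (∀ k, HEl K 1 0 • b k = (μ + (k : K)) • b k)

lemma oneB {Q : Type*} [AddCommGroup Q] [Module K Q] [Module (In K 1) Q] [IsScalarTower K (In K 1) Q]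
    (p : Prop) (μ : K) (hk : ¬ p → ∀ i : Fin 1, ∀ q : Q, eE K 1 i • q = 0) {v : Q} (hv : v ≠ 0)
    (hd : p → ∀ i : Fin 1, dEl K 1 i • v = 0) (hH : ∀ i : Fin 1, HEl K 1 i • v = μ • v)
    (hgen : ∀ N : Submodule (In K 1) Q, v ∈ N → N = ⊤) : ∃ b : ℤ → Q, OneB p μ b := by
  obtain ⟨B, hB⟩ := std_basis (D := {i : Fin 1 | p}) (fun i hi => hk hi i) hv (fun i hi => hd hi i)
    (μ := fun _ => μ) hH hgen
  have up : ∀ k l : ℤ, Function.update (fun _ : Fin 1 => k) 0 l = fun _ => l := by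
    intro k l
    ext i
    obtain rfl : i = 0 := Subsingleton.elim _ _
    simp
  let σ : ZD {i : Fin 1 | p} ≃ {k : ℤ // p → 0 ≤ k} :=
    { toFun := fun z => ⟨z.1 0, fun hp => z.2 0 hp⟩
      invFun := fun k => ⟨fun _ => k.1, fun i hp => k.2 hp⟩
      left_inv := fun z => by
        apply Subtype.ext
        ext i
        obtain rfl : i = 0 := Subsingleton.elim _ _
        rfl
      right_inv := fun k => rfl }
  refine ⟨fun k => sh K 1 (fun _ => k) • v, ⟨B.reindex σ, fun k => ?_⟩, fun k => ?_, fun hp k hk => ?_,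
    fun k hk' => ?_, fun k => ?_⟩
  · rw [Module.Basis.reindex_apply, hB]; rfl
  · rw [b_d, up]
  · exact b_zero (hd hp 0) hk
  · rw [b_int (D := {i : Fin 1 | p}) (fun i hi => hk hi i) v 0 (z := fun _ => k) hk', up]
  · exact b_H (hH 0) _

end MslNT

section Realize
universe u'
variable {K : Type u'} [Field K] [CharZero K] {n : ℕ}
variable {M : Type*} [AddCommGroup M] [Module K M] [Module (In K n) M] [IsScalarTower K (In K n) M]

lemma tprodMap_tprod (Mi : Fin n → ModN K 1) (i : Fin n) (a : In K 1) (f : ∀ j, (Mi j).carrier) :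
    tprodMap K n Mi i a (PiTensorProduct.tprod K f)
      = PiTensorProduct.tprod K (Function.update f i (a • f i)) := by
  rw [tprodMap, PiTensorProduct.map_tprod]
  congr 1
  ext j
  by_cases h : j = i
  · subst h
    simp only [Function.update_self]
    rfl
  · simp [Function.update_of_ne h]

lemma exists_factor (lam : Fin n → K) (D : Set (Fin n)) (i : Fin n) :
    ∃ Q : ModN K 1, (i ∈ D → Nonempty (Q.carrier ≃ₗ[In K 1] P K 1)) ∧
      (i ∉ D → Nonempty (Q.carrier ≃ₗ[In K 1] Msl K 1 (lam i))) ∧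
      ∃ b : ℤ → Q.carrier, (i ∈ D → OneB (i ∈ D) (1 : K) b) ∧ (i ∉ D → OneB (i ∈ D) (lam i) b) := by
  by_cases hi : i ∈ D
  · obtain ⟨b, hb⟩ := oneB (Q := P K 1) (i ∈ D) (1 : K) (fun h => absurd hi h) (v := 1) one_ne_zero
      (fun _ j => P_d_one j) (fun j => by rw [P_H_one]) (fun N hN => P_gen N hN)
    exact ⟨⟨P K 1⟩, fun _ => ⟨LinearEquiv.refl _ _⟩, fun h => absurd hi h, b, fun _ => hb, fun h => absurd hi h⟩
  · obtain ⟨b, hb⟩ := oneB (Q := Msl K 1 (lam i)) (i ∈ D) (lam i) (fun _ => Msl_kill _) (mv_ne (lam i))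
      (fun h => absurd h hi) (mv_H _) (mv_gen _)
    exact ⟨⟨Msl K 1 (lam i)⟩, fun h => absurd h hi, fun _ => ⟨LinearEquiv.refl _ _⟩, b, fun h => absurd h hi, fun _ => hb⟩

open Classical in
lemma Ty.realizes {lam : Fin n → K} {D : Set (Fin n)} (h : Ty lam D M) (hs : IsSimpleModule (In K n) M) :
    RealizesMD K n lam D M := by
  have : Nontrivial M := IsSimpleModule.nontrivial (In K n) M
  obtain ⟨v, hv, hd, hH⟩ := h.exists_vec
  obtain ⟨μ, hμ⟩ : ∃ μ : Fin n → K, μ = fun i => if i ∈ D then 1 else lam i := ⟨_, rfl⟩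
  have hH' : ∀ i, HEl K n i • v = μ i • v := by
    intro i
    by_cases hi : i ∈ D
    · rw [Adm_H_one (mem_Adm.mpr hd) hi, hμ]; simp [hi]
    · rw [hH i hi, hμ]; simp [hi]
  have hgen : ∀ N : Submodule (In K n) M, v ∈ N → N = ⊤ := by
    intro N hN
    rcases eq_bot_or_eq_top N with h0 | h0
    · exact absurd (by simpa [h0] using hN) hv
    · exact h0
  obtain ⟨C, hC⟩ := std_basis h.kill hv hd hH' hgen
  choose Mi hP hM b hbP hbM using exists_factor lam D
  have hb : ∀ i, OneB (i ∈ D) (μ i) (b i) := by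
    intro i
    by_cases hi : i ∈ D
    · have := hbP i hi
      rw [hμ]; simpa [hi] using this
    · have := hbM i hi
      rw [hμ]; simpa [hi] using this
  have hb1 := fun i => (hb i).1
  have bd := fun i => (hb i).2.1
  have bz := fun i => (hb i).2.2.1
  have bi := fun i => (hb i).2.2.2.1
  have bH := fun i => (hb i).2.2.2.2
  choose B hB using hb1
  let T := Basis.piTensorProduct (R := K) B
  let σ : ZD D ≃ (∀ i, {k : ℤ // i ∈ D → 0 ≤ k}) :=
    { toFun := fun z i => ⟨z.1 i, z.2 i⟩
      invFun := fun k => ⟨fun i => (k i).1, fun i hi => (k i).2 hi⟩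
      left_inv := fun z => rfl
      right_inv := fun k => rfl }
  let φ := C.equiv T σ
  have hφ : ∀ z : Fin n → ℤ, φ (sh K n z • v) = PiTensorProduct.tprod K (fun i => b i (z i)) := by
    intro z
    by_cases hz : ∀ i ∈ D, 0 ≤ z i
    · have h1 := hC ⟨z, hz⟩
      rw [← h1, Module.Basis.equiv_apply, Basis.piTensorProduct_apply]
      congr 1
      ext i
      rw [hB]
      rfl
    · push Not at hz
      obtain ⟨i, hi, hz⟩ := hz
      rw [b_zero (hd i hi) hz, map_zero]
      symm
      apply MultilinearMap.map_coord_zero _ i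
      exact bz i hi _ hz
  have upd : ∀ (z : Fin n → ℤ) (i : Fin n) (k : ℤ),
      Function.update (fun j => b j (z j)) i (b i k) = fun j => b j (Function.update z i k j) := by
    intro z i k
    ext j
    by_cases hj : j = i
    · subst hj; simp
    · simp [Function.update_of_ne hj]
  refine ⟨Mi, hP, hM, φ, fun i m => ⟨?_, ?_, ?_⟩⟩
  · have : φ.toLinearMap ∘ₗ DistribMulAction.toLinearMap K M (xEl K n i) = tprodMap K n Mi i (xEl K 1 0) ∘ₗ φ.toLinearMap := by
      apply C.ext
      intro z
      show φ (xEl K n i • C z) = tprodMap K n Mi i (xEl K 1 0) (φ (C z))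
      rw [hC, hφ, tprodMap_tprod, x_eq, x_eq, mul_smul, mul_smul, b_H (hH' i), smul_comm, b_int h.kill v i (z.2 i),
        map_smul, hφ, bH, smul_comm, bi i _ (z.2 i), MultilinearMap.map_update_smul, upd]
    exact LinearMap.congr_fun this m
  · have : φ.toLinearMap ∘ₗ DistribMulAction.toLinearMap K M (dEl K n i) = tprodMap K n Mi i (dEl K 1 0) ∘ₗ φ.toLinearMap := by
      apply C.ext
      intro z
      show φ (dEl K n i • C z) = tprodMap K n Mi i (dEl K 1 0) (φ (C z))
      rw [hC, hφ, tprodMap_tprod, b_d, bd, hφ, upd]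
    exact LinearMap.congr_fun this m
  · have : φ.toLinearMap ∘ₗ DistribMulAction.toLinearMap K M (intEl K n i) = tprodMap K n Mi i (intEl K 1 0) ∘ₗ φ.toLinearMap := by
      apply C.ext
      intro z
      show φ (intEl K n i • C z) = tprodMap K n Mi i (intEl K 1 0) (φ (C z))
      rw [hC, hφ, tprodMap_tprod, b_int h.kill v i (z.2 i), bi i _ (z.2 i), hφ, upd]
    exact LinearMap.congr_fun this m

end Realize

section Uniq
universe u'
variable {K : Type u'} [Field K] [CharZero K] {n : ℕ}
variable {M : Type*} [AddCommGroup M] [Module K M] [Module (In K n) M] [IsScalarTower K (In K n) M]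

lemma RealizesMD.kill {lam : Fin n → K} {D : Set (Fin n)} (h : RealizesMD K n lam D M) {i : Fin n} (hi : i ∉ D)
    (s : M) : s ∈ EE K M i := by
  obtain ⟨Mi, -, hM, φ, hφ⟩ := h
  obtain ⟨f⟩ := hM i hi
  have key : ∀ t, tprodMap K n Mi i (intEl K 1 0) (tprodMap K n Mi i (dEl K 1 0) t) = t := by
    intro t
    induction t using PiTensorProduct.induction_on with
    | smul_tprod r g =>
      rw [map_smul, map_smul, tprodMap_tprod, tprodMap_tprod, Function.update_self, Function.update_idem, ← mul_smul]
      congr 2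
      have : (intEl K 1 0 * dEl K 1 0) • g i = g i := by
        apply f.injective
        rw [map_smul, int_d, sub_smul, one_smul, Msl_kill, sub_zero]
      rw [this, Function.update_eq_self]
    | add x y hx hy => rw [map_add, map_add, hx, hy]
  intro k
  rw [mul_smul]
  generalize dEl K n i ^ k • s = s'
  have : (intEl K n i * dEl K n i) • s' = s' := by
    apply φ.injective
    rw [mul_smul, (hφ i _).2.2, (hφ i _).2.1, key]
  rw [int_d, sub_smul, one_smul, sub_eq_self] at this
  exact this

lemma P_LL (i : Fin n) : LL K (P K n) i = ⊤ := by
  apply P_gen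
  exact ⟨1, by rw [pow_one, P_d_one]⟩

lemma RealizesMD.nil {lam : Fin n → K} {D : Set (Fin n)} (h : RealizesMD K n lam D M) {i : Fin n} (hi : i ∈ D)
    (s : M) : s ∈ LL K M i := by
  obtain ⟨Mi, hP, -, φ, hφ⟩ := h
  obtain ⟨f⟩ := hP i hi
  have step : ∀ (k : ℕ) (g : ∀ j, (Mi j).carrier), ((tprodMap K n Mi i (dEl K 1 0)) ^ k) (PiTensorProduct.tprod K g)
      = PiTensorProduct.tprod K (Function.update g i (dEl K 1 0 ^ k • g i)) := by
    intro k
    induction k with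
    | zero => intro g; simp
    | succ k ih =>
      intro g
      rw [pow_succ', Module.End.mul_apply, ih, tprodMap_tprod, Function.update_self, Function.update_idem, ← mul_smul,
        ← pow_succ']
  have key : ∀ t, ∃ k : ℕ, ((tprodMap K n Mi i (dEl K 1 0)) ^ k) t = 0 := by
    intro t
    induction t using PiTensorProduct.induction_on with
    | smul_tprod r g =>
      have : f (g i) ∈ LL K (P K 1) (0 : Fin 1) := by rw [P_LL]; trivial
      obtain ⟨k, hk⟩ := this
      rw [← map_smul, LinearEquiv.map_eq_zero_iff] at hk
      refine ⟨k, ?_⟩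
      rw [map_smul, step, hk]
      have : PiTensorProduct.tprod K (Function.update g i (0 : (Mi i).carrier)) = 0 :=
        MultilinearMap.map_coord_zero _ i (Function.update_self _ _ _)
      rw [this, smul_zero]
    | add x y hx hy =>
      obtain ⟨k, hk⟩ := hx
      obtain ⟨l, hl⟩ := hy
      refine ⟨k + l, ?_⟩
      rw [map_add, add_comm k l, pow_add, Module.End.mul_apply, hk, map_zero, ← pow_add, add_comm l k, pow_add,
        Module.End.mul_apply, hl, map_zero, add_zero]
  have tr : ∀ (k : ℕ) (s : M), φ (dEl K n i ^ k • s) = ((tprodMap K n Mi i (dEl K 1 0)) ^ k) (φ s) := by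
    intro k
    induction k with
    | zero => intro s; simp
    | succ k ih => intro s; rw [pow_succ', mul_smul, (hφ i _).2.1, ih, pow_succ', Module.End.mul_apply]
  obtain ⟨k, hk⟩ := key (φ s)
  exact ⟨k, φ.injective (by rw [tr, hk, map_zero])⟩

lemma exists_simple {m : M} (hm : m ≠ 0) : ∃ p : Submodule (In K n) M, p ≤ Submodule.span (In K n) {m} ∧
    IsSimpleModule (In K n) (Submodule.span (In K n) {m} ⧸ Submodule.comap (Submodule.span (In K n) {m}).subtype p) := by
  set q := Submodule.span (In K n) {m} with hq
  have hfin : Module.Finite (In K n) q := Module.Finite.of_fg (Submodule.fg_span_singleton m)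
  have hne : (⊥ : Submodule (In K n) q) ≠ ⊤ := by
    intro h
    have h1 : (⟨m, Submodule.mem_span_singleton_self m⟩ : q) ∈ (⊥ : Submodule (In K n) q) := by rw [h]; trivial
    exact hm (congrArg Subtype.val ((Submodule.mem_bot _).mp h1))
  obtain ⟨p0, hp0, -⟩ := (eq_top_or_exists_le_coatom (⊥ : Submodule (In K n) q)).resolve_left hne
  refine ⟨p0.map q.subtype, Submodule.map_subtype_le _ _, ?_⟩
  rw [isSimpleModule_iff_isCoatom, Submodule.comap_map_eq_of_injective q.injective_subtype]
  exact hp0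

lemma InGWD.LL_EE {lam : Fin n → K} {D : Set (Fin n)} (h : InGWD K n lam D M) {i : Fin n} {m : M}
    (hD : (i ∈ D ∧ m ∈ EE K M i) ∨ (i ∉ D ∧ m ∈ LL K M i)) : m = 0 := by
  by_contra hm
  obtain ⟨p, hp, hs⟩ := exists_simple (K := K) (n := n) hm
  have hR := h.2.2 p _ hp hs
  have hnt := IsSimpleModule.nontrivial (In K n) (Submodule.span (In K n) {m} ⧸ Submodule.comap (Submodule.span (In K n) {m}).subtype p)
  obtain ⟨s, hs0⟩ := exists_ne (0 : Submodule.span (In K n) {m} ⧸ Submodule.comap (Submodule.span (In K n) {m}).subtype p)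
  apply hs0
  obtain ⟨⟨t, ht⟩, rfl⟩ := Submodule.Quotient.mk_surjective _ s
  apply Submodule.disjoint_def.mp (LL_EE_disj (K := K) i)
  · rcases hD with ⟨hi, -⟩ | ⟨hi, hm⟩
    · exact hR.nil hi _
    · have h1 : t ∈ LL K M i := ((Submodule.span_singleton_le_iff_mem _ _).mpr hm) ht
      obtain ⟨k, hk⟩ := h1
      refine ⟨k, ?_⟩
      rw [← Submodule.Quotient.mk_smul]
      have : dEl K n i ^ k • (⟨t, ht⟩ : Submodule.span (In K n) {m}) = 0 := Subtype.ext hk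
      rw [this]; rfl
  · rcases hD with ⟨hi, hm⟩ | ⟨hi, hm⟩
    · have h1 : t ∈ EE K M i := ((Submodule.span_singleton_le_iff_mem _ _).mpr hm) ht
      intro k
      rw [← Submodule.Quotient.mk_smul]
      have : (eE K n i * dEl K n i ^ k) • (⟨t, ht⟩ : Submodule.span (In K n) {m}) = 0 := Subtype.ext (h1 k)
      rw [this]; rfl
    · exact hR.kill hi _

lemma InGWD.le_MD {lam : Fin n → K} {D : Set (Fin n)} {N : Submodule (In K n) M} (h : InGWD K n lam D N) :
    N ≤ MD K M D := by
  have hF := FinC_of h.1 h.2.1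
  intro m hm
  rw [mem_MD]
  constructor
  · intro i hi
    obtain ⟨a, h1, h2⟩ := LL_EE_sup hF i (⟨m, hm⟩ : N)
    have h3 := h.LL_EE (Or.inl ⟨hi, h2⟩)
    rw [sub_smul, one_smul, sub_eq_zero] at h3
    rw [← h3] at h1
    obtain ⟨k, hk⟩ := h1
    exact ⟨k, congrArg Subtype.val hk⟩
  · intro i hi
    obtain ⟨a, h1, h2⟩ := LL_EE_sup hF i (⟨m, hm⟩ : N)
    have h3 := h.LL_EE (Or.inr ⟨hi, h1⟩)
    rw [sub_smul, one_smul, h3, sub_zero] at h2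
    intro k
    exact congrArg Subtype.val (h2 k)

lemma MD_bot {lam : Fin n → K} (h : FinC lam M) {D : Set (Fin n)} (hD : ¬ D ⊆ DD K n lam) : MD K M D = ⊥ := by
  by_contra hne
  have : Nontrivial (MD K M D) := Submodule.nontrivial_iff_ne_bot.mpr hne
  have hT := MD_Ty h D
  obtain ⟨v, hv, hd, -⟩ := hT.exists_vec
  obtain ⟨i, hi, hi'⟩ := Set.not_subset.mp hD
  apply hi'
  have hH : HEl K n i • v = (1 : K) • v := by rw [Adm_H_one (mem_Adm.mpr hd) hi, one_smul]
  obtain ⟨l, hl, hq⟩ := hT.fin i v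
  rw [aeval_smul_eval hH] at hq
  have h1 : (1 : K) ∈ l := by
    by_contra h1
    exact (smul_ne_zero (lp_eval_ne h1) hv) hq
  obtain ⟨z, hz⟩ := hl 1 h1
  exact ⟨1 - z, by push_cast; rw [hz]; ring⟩

lemma MD_InGWD {lam : Fin n → K} (h : FinC lam M) (D : Set (Fin n)) : InGWD K n lam D (MD K M D) := by
  have hT := MD_Ty h D
  exact ⟨hT.fin.gw, hT.fin.supp, fun p q _ hs => ((hT.sub q).quot _).realizes hs⟩

lemma uniq_aux {ι : Type*} {N A : ι → Submodule (In K n) M} (hA : iSupIndep A) (hN : ⨆ i, N i = ⊤)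
    (hle : ∀ i, N i ≤ A i) (i : ι) : N i = A i := by
  apply le_antisymm (hle i)
  have h1 : N i ⊔ ⨆ j ≠ i, A j = ⊤ := by
    rw [eq_top_iff, ← hN, iSup_le_iff]
    intro j
    by_cases hj : j = i
    · subst hj; exact le_sup_left
    · exact le_sup_of_le_right (le_trans (hle j) (le_iSup₂_of_le j hj le_rfl))
  have h2 : Disjoint (A i) (⨆ j ≠ i, A j) := hA i
  calc A i = (N i ⊔ ⨆ j ≠ i, A j) ⊓ A i := by rw [h1, top_inf_eq]
    _ = N i ⊔ ((⨆ j ≠ i, A j) ⊓ A i) := sup_inf_assoc_of_le _ (hle i)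
    _ ≤ N i := by rw [inf_comm, h2.eq_bot, sup_bot_eq]

end Uniq

/-- every generalized weight module with support in an orbit is a unique direct
sum of components in the categories `GW(𝕀_n, 𝒟_Ω)`, and every nonzero component is an
absolutely prime `𝕀_n`-module. -/
theorem statement18 (K : Type*) [Field K] [CharZero K] (n : ℕ)
    (lam : Fin n → K) (hnorm : IsNormalized K n lam)
    (M : Type*) [AddCommGroup M] [Module K M] [Module (In K n) M] [IsScalarTower K (In K n) M]
    (hgw : IsGenWeightModule K n M) (hsupp : supp K n M ⊆ orbitOf K n lam) :
    (∃! N : Set (Fin n) → Submodule (In K n) M,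
      (∀ D, ¬ D ⊆ DD K n lam → N D = ⊥) ∧
      (letI := Classical.decEq (Set (Fin n))
       DirectSum.IsInternal N) ∧
      (∀ D : Set (Fin n), InGWD K n lam D (N D))) ∧
    (∀ N : Set (Fin n) → Submodule (In K n) M,
      ((∀ D, ¬ D ⊆ DD K n lam → N D = ⊥) ∧
       (letI := Classical.decEq (Set (Fin n))
        DirectSum.IsInternal N) ∧
       (∀ D : Set (Fin n), InGWD K n lam D (N D))) →
      ∀ D : Set (Fin n), N D ≠ ⊥ → IsAbsolutelyPrime K n (N D)) := by
  have hF := FinC_of hgw hsupp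
  letI := Classical.decEq (Set (Fin n))
  have huniq : ∀ N : Set (Fin n) → Submodule (In K n) M,
      DirectSum.IsInternal N → (∀ D : Set (Fin n), InGWD K n lam D (N D)) → N = MD K M := by
    intro N hN hG
    rw [DirectSum.isInternal_submodule_iff_iSupIndep_and_iSup_eq_top] at hN
    funext D
    exact uniq_aux MD_indep hN.2 (fun D => (hG D).le_MD) D
  refine ⟨⟨MD K M, ⟨fun D hD => MD_bot hF hD, ?_, fun D => MD_InGWD hF D⟩, fun N hN => huniq N hN.2.1 hN.2.2⟩, ?_⟩
  · show DirectSum.IsInternal (MD K M : Set (Fin n) → Submodule (In K n) M)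
    rw [DirectSum.isInternal_submodule_iff_iSupIndep_and_iSup_eq_top]
    exact ⟨MD_indep, MD_top hF⟩
  · intro N hN D hne
    obtain rfl := huniq N hN.2.1 hN.2.2
    have : Nontrivial (MD K M D) := Submodule.nontrivial_iff_ne_bot.mpr hne
    exact (MD_Ty hF D).absPrime

end IDO
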